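/- Let n ≥ 3 and let G be the superoperator of one step of the local random quantum circuit on n qubits for the third moment: G(X) := (1/n) ∑_{i∈ℤ/n} ∫_{U(4)} E_i(U)^{⊗3} X (E_i(U)^{⊗3})^† dμ_H(U), acting on 2^{3n}×2^{3n} complex matrices, and let G_H(X) := ∫_{U(2^n)} V^{⊗3} X (V^{⊗3})^† dμ_H(V) be the Haar third-moment superoperator. Then for every integer k ≥ 0 and every matrix X, ‖G^k(X) − G_H(X)‖_2 ≤ (1 − 1/(5n))^k · ‖X‖_2, where ‖·‖_2 is the Frobenius norm and G^k is the k-fold composition. Consequently, local random quantum circuits of size 5n·ln(1/ε) form an ε-approximate unitary 3-design. -/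

import Mathlib

open MeasureTheory
open scoped BigOperators Matrix

/-- Borel measurable-space structure on unitary groups of complex matrices. -/
noncomputable instance unitaryGroup.measurableSpace (m : Type*) [Fintype m] [DecidableEq m] :
    MeasurableSpace (Matrix.unitaryGroup m ℂ) := borel _

instance unitaryGroup.borelSpace (m : Type*) [Fintype m] [DecidableEq m] :
    BorelSpace (Matrix.unitaryGroup m ℂ) := ⟨rfl⟩

/-- The `t`-fold Kronecker (tensor) power of a matrix, indexed by tuples. -/
def tensorPow {α : Type*} [Fintype α] (t : ℕ) (A : Matrix α α ℂ) :
    Matrix (Fin t → α) (Fin t → α) ℂ :=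
  fun x y => ∏ a : Fin t, A (x a) (y a)

/-- The Frobenius (Hilbert-Schmidt) norm of a matrix. -/
noncomputable def frobNorm {α : Type*} [Fintype α] (M : Matrix α α ℂ) : ℝ :=
  Real.sqrt (∑ x : α, ∑ y : α, ‖M x y‖ ^ 2)

/-- `E_i(U)`: the two-qubit gate `U ∈ U(4)` applied to the neighbouring qubits `i, i+1` of a
ring of `n` qubits, acting as the identity elsewhere. -/
def ringGate (n : ℕ) [NeZero n] (i : ZMod n)
    (U : Matrix (Fin 2 × Fin 2) (Fin 2 × Fin 2) ℂ) :
    Matrix (ZMod n → Fin 2) (ZMod n → Fin 2) ℂ :=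
  fun x y => U (x i, x (i + 1)) (y i, y (i + 1)) *
    ∏ k ∈ Finset.univ.filter fun k => k ≠ i ∧ k ≠ i + 1, (if x k = y k then (1 : ℂ) else 0)

/-- One step of the local random quantum circuit on `n` qubits, for the third moment:
`G(X) = (1/n) ∑_i ∫ E_i(U)^{⊗3} X (E_i(U)^{⊗3})† dμ(U)` (entrywise). -/
noncomputable def localStep (n : ℕ) [NeZero n]
    (μ : Measure (Matrix.unitaryGroup (Fin 2 × Fin 2) ℂ))
    (X : Matrix (Fin 3 → ZMod n → Fin 2) (Fin 3 → ZMod n → Fin 2) ℂ) :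
    Matrix (Fin 3 → ZMod n → Fin 2) (Fin 3 → ZMod n → Fin 2) ℂ :=
  fun x y => (n : ℂ)⁻¹ * ∑ i : ZMod n,
    ∫ U : Matrix.unitaryGroup (Fin 2 × Fin 2) ℂ,
      (tensorPow 3 (ringGate n i (U : Matrix (Fin 2 × Fin 2) (Fin 2 × Fin 2) ℂ)) * X *
        (tensorPow 3 (ringGate n i (U : Matrix (Fin 2 × Fin 2) (Fin 2 × Fin 2) ℂ)))ᴴ) x y ∂μ

/-- The Haar third-moment superoperator on `n` qubits:
`G_H(X) = ∫ V^{⊗3} X (V^{⊗3})† dμ_H(V)` over `U(2^n)` (entrywise). -/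
noncomputable def haarStep (n : ℕ) [NeZero n]
    (μH : Measure (Matrix.unitaryGroup (ZMod n → Fin 2) ℂ))
    (X : Matrix (Fin 3 → ZMod n → Fin 2) (Fin 3 → ZMod n → Fin 2) ℂ) :
    Matrix (Fin 3 → ZMod n → Fin 2) (Fin 3 → ZMod n → Fin 2) ℂ :=
  fun x y =>
    ∫ V : Matrix.unitaryGroup (ZMod n → Fin 2) ℂ,
      (tensorPow 3 (V : Matrix (ZMod n → Fin 2) (ZMod n → Fin 2) ℂ) * X *
        (tensorPow 3 (V : Matrix (ZMod n → Fin 2) (ZMod n → Fin 2) ℂ))ᴴ) x y ∂μH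


/-- Integer rows of the sum-of-squares certificate `certP`. -/
def certPRows : List (List ℤ) :=
  [[0, 8, 0, 4, 4, 0, -8, 0, -4, 0, 0, -4, 0, 2, 0, 1, 1, 0, -2, 0, -1, 0, 0, -1, -2, 0, -1, 0, 0, -1, 0, 2, 0, 1, 1, 0],
   [0, 0, 8, 4, 4, 0, 0, 0, 2, 1, 1, 0, -8, -4, 0, 0, 0, -4, -2, -1, 0, 0, 0, -1, -2, -1, 0, 0, 0, -1, 0, 0, 2, 1, 1, 0],
   [0, 0, 0, 23, -7, 16, 0, 0, 0, 6, -2, 4, 0, 0, 0, 6, -2, 4, -13, -6, -6, 0, -3, -4, 5, 2, 2, 3, 0, 4, -16, -8, -8, 4, -4, 0],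
   [0, 0, 0, 0, 120, 120, 0, 0, 0, -1, 31, 30, 0, 0, 0, -1, 31, 30, 6, 1, 1, 0, 12, 16, -66, -31, -31, -12, 0, -16, -120, -60, -60, -16, 16, 0],
   [0, 0, 0, 0, 0, 0, 0, 0, 29, 15, 15, 1, 0, -13, 0, -6, -6, 1, -6, -15, 6, 0, -4, -1, -6, -15, 6, -4, 0, -1, 0, 1, 1, 1, 1, 0],
   [0, 0, 0, 0, 0, 0, 0, 0, 0, 2756, -956, 1800, 0, 90, 0, 191, -41, 60, -1056, -2756, -191, 0, -1632, 259, 336, 956, 41, 1152, 0, 491, 0, -810, 60, -259, -491, 0],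
   [0, 0, 0, 0, 0, 0, 0, 0, 0, 0, 480, 480, 0, 24, 0, 5, 35, 16, -6, 0, -5, 0, 116, 115, -186, -480, -35, -244, 0, 85, 0, -216, 16, -115, -85, 0],
   [0, 0, 0, 0, 0, 0, 0, 0, 0, 0, 0, 0, 0, 66, 0, 35, 35, 4, -24, 0, -35, 0, -16, -5, -24, 0, -35, -16, 0, -5, 0, 6, 4, 5, 5, 0],
   [0, 0, 0, 0, 0, 0, 0, 0, 0, 0, 0, 0, 0, 0, 0, 833, -289, 544, -294, 0, -833, 0, -460, 79, 102, 0, 289, 332, 0, 145, 0, 24, -248, -79, -145, 0],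
   [0, 0, 0, 0, 0, 0, 0, 0, 0, 0, 0, 0, 0, 0, 0, 0, 68, 68, 0, 0, 0, 0, 16, 16, -24, 0, -68, -32, 0, 12, 0, 3, -31, -16, -12, 0],
   [0, 0, 0, 0, 0, 0, 0, 0, 0, 0, 0, 0, 0, 0, 0, 0, 0, 0, 7, 0, 0, 0, -2, 5, 0, 0, 0, 1, 0, 1, 0, -3, -3, -5, -1, 0],
   [0, 0, 0, 0, 0, 0, 0, 0, 0, 0, 0, 0, 0, 0, 0, 0, 0, 0, 0, 0, 0, 0, 52, 52, 7, 0, 0, -19, 0, -12, 0, -20, -20, -52, 12, 0],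
   [0, 0, 0, 0, 0, 0, 0, 0, 0, 0, 0, 0, 0, 0, 0, 0, 0, 0, 0, 0, 0, 0, 0, 0, 21, 0, 0, -5, 0, 16, 0, -8, -8, 0, -16, 0],
   [0, 0, 0, 0, 0, 0, 0, 0, 0, 0, 0, 0, 0, 0, 0, 0, 0, 0, 0, 0, 0, 0, 0, 0, 0, 0, 0, 2, 0, 2, 0, -1, -1, 0, -2, 0],
   [0, 0, 0, 0, 0, 0, 0, 0, 0, 0, 0, 0, 0, 0, 0, 0, 0, 0, 0, 0, 0, 0, 0, 0, 0, 0, 0, 0, 0, 0, 0, 1, -1, 0, 0, 0]]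

/-- Weights of the sum-of-squares certificate `certP`. -/
def certPWt : List ℕ :=
  [38981604261600, 38981604261600, 3389704718400, 112990157280, 2688386500800, 227608920, 6600658680, 413441257320, 2481640200, 327576506400, 27516426537600, 529162048800, 2998584943200, 311852834092800, 818613689493600]

/-- Multiplier matrix of the certificate `certP`. -/
def certPMul : List (List ℤ) :=
  [[18648606977, -2406271868, -2406271868, 601567967, 601567967, -2406271868],
   [-2406271868, 18648606977, 601567967, -2406271868, -2406271868, 601567967],
   [-2406271868, 601567967, 18648606977, -2406271868, -2406271868, 601567967],
   [601567967, -2406271868, -2406271868, 18648606977, 601567967, -2406271868],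
   [601567967, -2406271868, -2406271868, 601567967, 18648606977, -2406271868],
   [-2406271868, 601567967, 601567967, -2406271868, -2406271868, 18648606977]]

/-- Integer rows of the sum-of-squares certificate `certM`. -/
def certMRows : List (List ℤ) :=
  [[64, 32, 32, 16, 16, 32, 16, 8, 8, 4, 4, 8, 16, 8, 8, 4, 4, 8, 4, 2, 2, 1, 1, 2, 4, 2, 2, 1, 1, 2, 16, 8, 8, 4, 4, 8],
   [0, 64, 0, 32, 32, 0, 80, 56, 40, 28, 28, 40, 0, 16, 0, 8, 8, 0, 20, 14, 10, 7, 7, 10, 20, 14, 10, 7, 7, 10, 0, 16, 0, 8, 8, 0],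
   [0, 0, 64, 32, 32, 0, 0, 0, 16, 8, 8, 0, 80, 40, 56, 28, 28, 40, 20, 10, 14, 7, 7, 10, 20, 10, 14, 7, 7, 10, 0, 0, 16, 8, 8, 0],
   [0, 0, 0, 96, -32, 64, 0, 0, 0, 24, -8, 16, 0, 0, 0, 24, -8, 16, 60, 30, 30, 21, 13, 34, -20, -10, -10, 1, -7, -6, 80, 40, 40, 44, 12, 56],
   [0, 0, 0, 0, 32, 32, 0, 0, 0, 0, 8, 8, 0, 0, 0, 0, 8, 8, 0, 0, 0, 0, 2, 2, 20, 10, 10, 5, 7, 12, 40, 20, 20, 10, 18, 28],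
   [0, 0, 0, 0, 0, 0, 16, 56, 8, 28, 28, 8, 0, 0, 0, 0, 0, 0, 4, 14, 2, 7, 7, 2, 4, 14, 2, 7, 7, 2, 0, 0, 0, 0, 0, 0],
   [0, 0, 0, 0, 0, 0, 0, 0, 16, 8, 8, 0, 0, 8, 0, 4, 4, 0, 4, 10, 6, 7, 7, 2, 4, 10, 6, 7, 7, 2, 0, 0, 0, 0, 0, 0],
   [0, 0, 0, 0, 0, 0, 0, 0, 0, 24, -8, 16, 0, 0, 0, 0, 0, 0, 12, 30, 6, 21, 13, 10, -4, -10, -2, 1, -7, 2, 0, 8, 0, 4, 4, 0],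
   [0, 0, 0, 0, 0, 0, 0, 0, 0, 0, 8, 8, 0, 0, 0, 0, 0, 0, 0, 0, 0, 0, 2, 2, 4, 10, 2, 5, 7, 4, 0, 4, 0, 2, 2, 0],
   [0, 0, 0, 0, 0, 0, 0, 0, 0, 0, 0, 0, 16, 8, 56, 28, 28, 8, 4, 2, 14, 7, 7, 2, 4, 2, 14, 7, 7, 2, 0, 0, 0, 0, 0, 0],
   [0, 0, 0, 0, 0, 0, 0, 0, 0, 0, 0, 0, 0, 24, 0, 12, 12, 0, 4, 2, 14, 7, 7, 2, 4, 2, 14, 7, 7, 2, 0, 0, 0, 0, 0, 0],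
   [0, 0, 0, 0, 0, 0, 0, 0, 0, 0, 0, 0, 0, 0, 0, 24, -8, 16, 12, 6, 30, 21, 13, 10, -4, -2, -10, 1, -7, 2, 0, 0, 8, 4, 4, 0],
   [0, 0, 0, 0, 0, 0, 0, 0, 0, 0, 0, 0, 0, 0, 0, 0, 8, 8, 0, 0, 0, 0, 2, 2, 4, 2, 10, 5, 7, 4, 0, 0, 4, 2, 2, 0],
   [0, 0, 0, 0, 0, 0, 0, 0, 0, 0, 0, 0, 0, 0, 0, 0, 0, 0, 116, 10, 10, 35, -37, 94, 4, 2, 2, -17, 7, -10, 16, 32, 32, 100, 4, 56],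
   [0, 0, 0, 0, 0, 0, 0, 0, 0, 0, 0, 0, 0, 0, 0, 0, 0, 0, 0, 126, 126, 441, 21, 210, 4, 2, 2, -17, 7, -10, 16, 32, 32, 100, 4, 56],
   [0, 0, 0, 0, 0, 0, 0, 0, 0, 0, 0, 0, 0, 0, 0, 0, 0, 0, 0, 0, 0, 0, 30, 30, -4, -2, -2, 11, -7, 4, 8, 16, 16, 38, 14, 28],
   [0, 0, 0, 0, 0, 0, 0, 0, 0, 0, 0, 0, 0, 0, 0, 0, 0, 0, 0, 0, 0, 0, 0, 0, 746, 58, 58, -199, 203, 634, 128, 256, 256, 128, 704, 448],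
   [0, 0, 0, 0, 0, 0, 0, 0, 0, 0, 0, 0, 0, 0, 0, 0, 0, 0, 0, 0, 0, 0, 0, 0, 0, 402, 402, 87, 1407, 690, 64, 128, 128, 64, 352, 224],
   [0, 0, 0, 0, 0, 0, 0, 0, 0, 0, 0, 0, 0, 0, 0, 0, 0, 0, 0, 0, 0, 0, 0, 0, 0, 0, 0, 9, 0, 9, 2, 4, 4, 2, 11, 7],
   [0, 0, 0, 0, 0, 0, 0, 0, 0, 0, 0, 0, 0, 0, 0, 0, 0, 0, 0, 0, 0, 0, 0, 0, 0, 0, 0, 0, 0, 0, 4, -1, -1, 4, 4, 14],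
   [0, 0, 0, 0, 0, 0, 0, 0, 0, 0, 0, 0, 0, 0, 0, 0, 0, 0, 0, 0, 0, 0, 0, 0, 0, 0, 0, 0, 0, 0, 0, 1, -1, 0, 0, 0]]

/-- Weights of the sum-of-squares certificate `certM`. -/
def certMWt : List ℕ :=
  [71024422, 15219519, 15219519, 5073173, 40585384, 76097595, 228292785, 76097595, 608780760, 76097595, 76097595, 76097595, 608780760, 2624055, 999640, 40585384, 62176, 97440, 387681280, 811707680, 21916107360]

/-- Multiplier matrix of the certificate `certM`. -/
def certMMul : List (List ℤ) :=
  [[0, 0, 0, 0, 0, 0],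
   [0, 0, 0, 0, 0, 0],
   [0, 0, 0, 0, 0, 0],
   [0, 0, 0, 0, 0, 0],
   [0, 0, 0, 0, 0, 0],
   [0, 0, 0, 0, 0, 0]]

/-- The six permutations of three letters. -/
def pf : Fin 6 → Equiv.Perm (Fin 3) :=
  ![1, Equiv.swap 1 2, Equiv.swap 0 1, finRotate 3, (finRotate 3)⁻¹, Equiv.swap 0 2]

theorem pf_bij : Function.Bijective pf := by
  constructor <;> decide +kernel

/-- Local configurations of a single site (three rows, three columns). -/
abbrev Loc := (Fin 3 → Fin 2) × (Fin 3 → Fin 2)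

/-- Gram table of the permutation vectors of a single site. -/
def gT : Fin 6 → Fin 6 → ℤ :=
  ![![8, 4, 4, 2, 2, 4], ![4, 8, 2, 4, 4, 2], ![4, 2, 8, 4, 4, 2],
    ![2, 4, 4, 8, 2, 4], ![2, 4, 4, 2, 8, 4], ![4, 2, 2, 4, 4, 8]]

theorem gT_symm : ∀ p q, gT p q = gT q p := by decide +kernel

/-- Integer version of the permutation vectors. -/
def vZ (p : Fin 6) (s : Loc) : ℤ := if ∀ a, s.1 a = s.2 (pf p a) then 1 else 0

theorem gT_eq : ∀ p q, gT p q = ∑ s : Loc, vZ p s * vZ q s := by decide +kernel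

def rowP (k : Fin 15) (a b : Fin 6) : ℤ := (certPRows.getD k []).getD (6 * a + b) 0
def rowM (k : Fin 21) (a b : Fin 6) : ℤ := (certMRows.getD k []).getD (6 * a + b) 0
def wtP (k : Fin 15) : ℕ := certPWt.getD k 0
def wtM (k : Fin 21) : ℕ := certMWt.getD k 0
def mulP (a b : Fin 6) : ℤ := (certPMul.getD a []).getD b 0

theorem certP_ok : ∀ a b c d : Fin 6,
    3031902553680 * (2 * (gT a c ^ 2 * gT b d) - 5 * (gT d a * gT c a * gT c b)) +
      ∑ r : Fin 6, ∑ t : Fin 6, mulP r t * (gT r a ^ 2 * gT r b) * (gT t c ^ 2 * gT t d) =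
    ∑ k : Fin 15, (wtP k : ℤ) * rowP k a b * rowP k c d := by decide +kernel

theorem certM_ok : ∀ a b c d : Fin 6,
    81170768 * (2 * (gT a c ^ 2 * gT b d) + 5 * (gT d a * gT c a * gT c b)) =
    ∑ k : Fin 21, (wtM k : ℤ) * rowM k a b * rowM k c d := by decide +kernel


theorem herm_sos {I K : Type*} [Fintype I] [Fintype K] (N : I → I → ℤ) (wt : K → ℕ)
    (row : K → I → ℤ) (h : ∀ i j, N i j = ∑ k, (wt k : ℤ) * row k i * row k j) (z : I → ℂ) :
    0 ≤ (∑ i, ∑ j, (N i j : ℂ) * (z i * (starRingEnd ℂ) (z j))).re := by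
  have : (∑ i, ∑ j, (N i j : ℂ) * (z i * (starRingEnd ℂ) (z j))) =
      ((∑ k, (wt k : ℝ) * Complex.normSq (∑ i, (row k i : ℂ) * z i) : ℝ) : ℂ) := by
    push_cast
    simp_rw [← Complex.mul_conj, map_sum, Finset.sum_mul_sum, Finset.mul_sum, h]
    push_cast
    simp_rw [Finset.sum_mul]
    rw [Finset.sum_comm' (t' := Finset.univ) (s' := fun _ => Finset.univ) (by simp)]
    rw [Finset.sum_comm]
    rw [Finset.sum_congr rfl (fun i _ => Finset.sum_comm)]
    rw [Finset.sum_comm]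
    refine Finset.sum_congr rfl fun k _ => Finset.sum_congr rfl fun i _ =>
      Finset.sum_congr rfl fun j _ => ?_
    simp
    ring
  rw [this, Complex.ofReal_re]
  exact Finset.sum_nonneg fun k _ => mul_nonneg (Nat.cast_nonneg _) (Complex.normSq_nonneg _)

def formA (i j : Fin 6 × Fin 6) : ℤ := gT i.1 j.1 ^ 2 * gT i.2 j.2
def formJ (i j : Fin 6 × Fin 6) : ℤ := gT j.2 i.1 * gT j.1 i.1 * gT j.1 i.2
def formQ (r : Fin 6) (i : Fin 6 × Fin 6) : ℤ := gT r i.1 ^ 2 * gT r i.2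

theorem form_bound (z : Fin 6 × Fin 6 → ℂ) (hz : ∀ r, ∑ i, (formQ r i : ℂ) * z i = 0) :
    |5 * (∑ i, ∑ j, (formJ i j : ℂ) * (z i * (starRingEnd ℂ) (z j))).re| ≤
      2 * (∑ i, ∑ j, (formA i j : ℂ) * (z i * (starRingEnd ℂ) (z j))).re := by
  have hP := herm_sos (fun i j => 3031902553680 * (2 * formA i j - 5 * formJ i j) +
      ∑ r : Fin 6, ∑ t : Fin 6, mulP r t * formQ r i * formQ t j) wtP (fun k i => rowP k i.1 i.2)
      (fun i j => certP_ok i.1 i.2 j.1 j.2) z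
  have hM := herm_sos (fun i j => 81170768 * (2 * formA i j + 5 * formJ i j))
      wtM (fun k i => rowM k i.1 i.2)
      (fun i j => certM_ok i.1 i.2 j.1 j.2) z
  have hQ : ∑ i, ∑ j, ((∑ r : Fin 6, ∑ t : Fin 6, mulP r t * formQ r i * formQ t j : ℤ) : ℂ)
      * (z i * (starRingEnd ℂ) (z j)) = 0 := by
    have : ∀ r t : Fin 6, ∑ i, ∑ j, ((mulP r t * formQ r i * formQ t j : ℤ) : ℂ)
      * (z i * (starRingEnd ℂ) (z j)) = 0 := by
      intro r t
      have : ∑ i, ∑ j, ((mulP r t * formQ r i * formQ t j : ℤ) : ℂ)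
        * (z i * (starRingEnd ℂ) (z j)) = (mulP r t : ℂ) * ((∑ i, (formQ r i : ℂ) * z i) *
          (starRingEnd ℂ) (∑ i, (formQ t i : ℂ) * z i)) := by
        simp_rw [map_sum, Finset.sum_mul_sum, Finset.mul_sum]
        refine Finset.sum_congr rfl fun i _ => Finset.sum_congr rfl fun j _ => ?_
        push_cast
        simp
        ring
      rw [this, hz]; simp
    push_cast at this ⊢
    simp_rw [Finset.sum_mul]
    rw [Finset.sum_congr rfl (fun i _ => Finset.sum_comm)]
    rw [Finset.sum_comm]
    rw [Finset.sum_congr rfl (fun r _ => Finset.sum_congr rfl (fun i _ => Finset.sum_comm))]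
    rw [Finset.sum_congr rfl (fun r _ => Finset.sum_comm)]
    simp [this]
  have e1 : ∑ i, ∑ j, ((3031902553680 * (2 * formA i j - 5 * formJ i j) +
      ∑ r : Fin 6, ∑ t : Fin 6, mulP r t * formQ r i * formQ t j : ℤ) : ℂ)
       * (z i * (starRingEnd ℂ) (z j)) =
      ((3031902553680 : ℝ) : ℂ) * (((2 : ℝ) : ℂ) * ∑ i, ∑ j, (formA i j : ℂ) * (z i * (starRingEnd ℂ) (z j))
        - ((5 : ℝ) : ℂ) * ∑ i, ∑ j, (formJ i j : ℂ) * (z i * (starRingEnd ℂ) (z j))) := by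
    rw [← add_zero (_ * _), ← hQ]
    simp_rw [Finset.mul_sum, ← Finset.sum_sub_distrib, Finset.mul_sum, ← Finset.sum_add_distrib]
    refine Finset.sum_congr rfl fun i _ => Finset.sum_congr rfl fun j _ => ?_
    rw [Int.cast_add]
    push_cast
    ring
  have e2 : ∑ i, ∑ j, ((81170768 * (2 * formA i j + 5 * formJ i j) : ℤ) : ℂ)
       * (z i * (starRingEnd ℂ) (z j)) =
      ((81170768 : ℝ) : ℂ) * (((2 : ℝ) : ℂ) * ∑ i, ∑ j, (formA i j : ℂ) * (z i * (starRingEnd ℂ) (z j))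
        + ((5 : ℝ) : ℂ) * ∑ i, ∑ j, (formJ i j : ℂ) * (z i * (starRingEnd ℂ) (z j))) := by
    simp_rw [Finset.mul_sum, ← Finset.sum_add_distrib, Finset.mul_sum]
    refine Finset.sum_congr rfl fun i _ => Finset.sum_congr rfl fun j _ => ?_
    push_cast
    ring
  rw [e1, Complex.re_ofReal_mul, Complex.sub_re, Complex.re_ofReal_mul, Complex.re_ofReal_mul] at hP
  rw [e2, Complex.re_ofReal_mul, Complex.add_re, Complex.re_ofReal_mul, Complex.re_ofReal_mul] at hM
  rw [abs_le]
  constructor <;> nlinarith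


/-- Permutation vectors of a single site. -/
noncomputable def vC (p : Fin 6) (s : Loc) : ℂ := if ∀ a, s.1 a = s.2 (pf p a) then 1 else 0

theorem vC_eq (p s) : vC p s = (vZ p s : ℂ) := by
  unfold vC vZ; split_ifs <;> simp

theorem vC_conj (p s) : (starRingEnd ℂ) (vC p s) = vC p s := by
  rw [vC_eq]; simp

theorem vC_gram (p q) : ∑ s, vC p s * vC q s = (gT p q : ℂ) := by
  rw [gT_eq]; push_cast; simp_rw [vC_eq]

/-- Vectors of the form `∑ |p⟩|p⟩ w_p`. -/
noncomputable def xw (w : Fin 6 → Loc → ℂ) (s1 s2 s3 : Loc) : ℂ :=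
  ∑ p, vC p s1 * vC p s2 * w p s3

theorem exists_proj (w : Fin 6 → Loc → ℂ) : ∃ c : Fin 6 × Fin 6 → ℂ,
    (∀ q p, ∑ s, vC q s * w p s = ∑ r, c (p, r) * (gT q r : ℂ)) ∧
    (∀ t : Fin 6 → ℂ, ∑ s, ‖∑ p, t p * ∑ r, c (p, r) * vC r s‖ ^ 2 ≤
      ∑ s, ‖∑ p, t p * w p s‖ ^ 2) := by
  let V : Submodule ℂ (EuclideanSpace ℂ Loc) :=
    Submodule.span ℂ (Set.range fun q : Fin 6 => (WithLp.toLp 2 (vC q) : EuclideanSpace ℂ Loc))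
  let W : Fin 6 → EuclideanSpace ℂ Loc := fun p => WithLp.toLp 2 (w p)
  have h1 : ∀ p, ∃ c : Fin 6 → ℂ, ∑ r, c r • (WithLp.toLp 2 (vC r) : EuclideanSpace ℂ Loc)
      = V.starProjection (W p) := by
    intro p
    exact (Submodule.mem_span_range_iff_exists_fun ℂ).1 (V.starProjection_apply_mem (W p))
  choose c hc using h1
  refine ⟨fun i => c i.1 i.2, ?_, ?_⟩
  · intro q p
    have h := V.sub_starProjection_mem_orthogonal (W p)
    rw [Submodule.mem_orthogonal] at h
    have h2 := h _ (Submodule.subset_span (Set.mem_range_self q))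
    rw [inner_sub_right, sub_eq_zero, ← hc, inner_sum] at h2
    simp only [inner_smul_right, PiLp.inner_apply, RCLike.inner_apply, vC_conj, W] at h2
    calc ∑ s, vC q s * w p s = ∑ s, w p s * vC q s := by simp_rw [mul_comm]
      _ = _ := h2
      _ = _ := by
        refine Finset.sum_congr rfl fun r _ => ?_
        rw [← vC_gram]; simp_rw [mul_comm]
  · intro t
    have h := V.norm_starProjection_apply_le (∑ p, t p • W p)
    have h' := pow_le_pow_left₀ (norm_nonneg _) h 2
    rw [map_sum] at h'
    simp_rw [map_smul, ← hc, EuclideanSpace.norm_sq_eq] at h'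
    simpa [W] using h'

theorem xw_form_A (c : Fin 6 × Fin 6 → ℂ) :
    ((∑ s1, ∑ s2, ∑ s3, ‖xw (fun p s => ∑ r, c (p, r) * vC r s) s1 s2 s3‖ ^ 2 : ℝ) : ℂ) =
      ∑ i, ∑ j, (formA i j : ℂ) * (c i * (starRingEnd ℂ) (c j)) := by
  have h : ∀ s1 s2 s3, ((‖xw (fun p s => ∑ r, c (p, r) * vC r s) s1 s2 s3‖ ^ 2 : ℝ) : ℂ) =
      ∑ i : Fin 6 × Fin 6, ∑ j : Fin 6 × Fin 6, (c i * (starRingEnd ℂ) (c j)) *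
        ((vC i.1 s1 * vC j.1 s1) * ((vC i.1 s2 * vC j.1 s2) * (vC i.2 s3 * vC j.2 s3))) := by
    intro s1 s2 s3
    have : xw (fun p s => ∑ r, c (p, r) * vC r s) s1 s2 s3 =
        ∑ i : Fin 6 × Fin 6, c i * (vC i.1 s1 * vC i.1 s2 * vC i.2 s3) := by
      rw [Fintype.sum_prod_type]
      unfold xw
      simp_rw [Finset.mul_sum]
      refine Finset.sum_congr rfl fun i _ => Finset.sum_congr rfl fun j _ => ?_
      ring
    rw [← Complex.normSq_eq_norm_sq, ← Complex.mul_conj, this, map_sum, Finset.sum_mul_sum]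
    refine Finset.sum_congr rfl fun i _ => Finset.sum_congr rfl fun j _ => ?_
    simp only [map_mul, vC_conj]
    ring
  push_cast at h ⊢
  simp_rw [h]
  simp_rw [Finset.sum_comm (s := (Finset.univ : Finset Loc)) (t := (Finset.univ : Finset (Fin 6 × Fin 6)))]
  simp_rw [← Finset.mul_sum, ← Finset.sum_mul, vC_gram, formA]
  refine Finset.sum_congr rfl fun i _ => Finset.sum_congr rfl fun j _ => ?_
  push_cast
  ring

theorem sum3_factor (F G H : Loc → ℂ) : ∑ s1, ∑ s2, ∑ s3, F s1 * (G s2 * H s3) =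
    (∑ s, F s) * ((∑ s, G s) * ∑ s, H s) := by
  simp_rw [Finset.sum_mul_sum, Finset.mul_sum]

theorem slice_one (w : Fin 6 → Loc → ℂ)
    (hw : ∀ r, ∑ s1, ∑ s2, ∑ s3, vC r s1 * vC r s2 * vC r s3 * xw w s1 s2 s3 = 0) :
    |5 * (∑ s1, ∑ s2, ∑ s3, xw w s1 s2 s3 * (starRingEnd ℂ) (xw w s3 s2 s1)).re| ≤
      2 * ∑ s1, ∑ s2, ∑ s3, ‖xw w s1 s2 s3‖ ^ 2 := by
  obtain ⟨c, hc, hn⟩ := exists_proj w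
  have hQ : ∀ r, ∑ i, (formQ r i : ℂ) * c i = 0 := by
    intro r
    rw [← hw r, Fintype.sum_prod_type]
    have : ∀ s1 s2 s3, vC r s1 * vC r s2 * vC r s3 * xw w s1 s2 s3 =
        ∑ p, (vC r s1 * vC p s1) * ((vC r s2 * vC p s2) * (vC r s3 * w p s3)) := by
      intro s1 s2 s3
      unfold xw
      rw [Finset.mul_sum]
      refine Finset.sum_congr rfl fun i _ => ?_
      ring
    simp_rw [this]
    simp_rw [Finset.sum_comm (s := (Finset.univ : Finset Loc)) (t := (Finset.univ : Finset (Fin 6)))]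
    simp_rw [sum3_factor, vC_gram, hc, Finset.mul_sum, formQ]
    refine Finset.sum_congr rfl fun i _ => Finset.sum_congr rfl fun j _ => ?_
    push_cast
    ring
  have hJ : ∑ s1, ∑ s2, ∑ s3, xw w s1 s2 s3 * (starRingEnd ℂ) (xw w s3 s2 s1) =
      ∑ i, ∑ j, (formJ i j : ℂ) * (c i * (starRingEnd ℂ) (c j)) := by
    have : ∀ s1 s2 s3, xw w s1 s2 s3 * (starRingEnd ℂ) (xw w s3 s2 s1) =
        ∑ p, ∑ q, (starRingEnd ℂ) (vC p s1 * w q s1) * ((vC q s2 * vC p s2) * (vC q s3 * w p s3)) := by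
      intro s1 s2 s3
      unfold xw
      rw [map_sum, Finset.sum_mul_sum]
      refine Finset.sum_congr rfl fun i _ => Finset.sum_congr rfl fun j _ => ?_
      simp only [map_mul, vC_conj]
      ring
    simp_rw [this]
    simp_rw [Finset.sum_comm (s := (Finset.univ : Finset Loc)) (t := (Finset.univ : Finset (Fin 6)))]
    simp_rw [sum3_factor, ← map_sum, vC_gram, hc, Fintype.sum_prod_type, map_sum, map_mul,
      map_intCast]
    refine Finset.sum_congr rfl fun p _ => ?_
    conv_rhs => rw [Finset.sum_comm]
    refine Finset.sum_congr rfl fun q _ => ?_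
    rw [mul_left_comm, Finset.sum_mul_sum, Finset.mul_sum]
    simp_rw [Finset.mul_sum, formJ]
    rw [Finset.sum_comm]
    refine Finset.sum_congr rfl fun i _ => Finset.sum_congr rfl fun j _ => ?_
    push_cast
    rw [gT_symm p j]
    ring
  have hb := form_bound c hQ
  rw [← xw_form_A, Complex.ofReal_re, ← hJ] at hb
  refine hb.trans ?_
  gcongr 2 * ?_
  refine Finset.sum_le_sum fun s1 _ => Finset.sum_le_sum fun s2 _ => ?_
  exact hn (fun p => vC p s1 * vC p s2)

theorem xw_add (w u : Fin 6 → Loc → ℂ) (s1 s2 s3) :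
    xw (w + u) s1 s2 s3 = xw w s1 s2 s3 + xw u s1 s2 s3 := by
  simp [xw, mul_add, Finset.sum_add_distrib]

theorem xw_sub (w u : Fin 6 → Loc → ℂ) (s1 s2 s3) :
    xw (w - u) s1 s2 s3 = xw w s1 s2 s3 - xw u s1 s2 s3 := by
  simp [xw, mul_sub, Finset.sum_sub_distrib]

theorem slice_two (w u : Fin 6 → Loc → ℂ)
    (hw : ∀ r, ∑ s1, ∑ s2, ∑ s3, vC r s1 * vC r s2 * vC r s3 * xw w s1 s2 s3 = 0)
    (hu : ∀ r, ∑ s1, ∑ s2, ∑ s3, vC r s1 * vC r s2 * vC r s3 * xw u s1 s2 s3 = 0) :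
    5 * (∑ s1, ∑ s2, ∑ s3, xw w s1 s2 s3 * (starRingEnd ℂ) (xw u s3 s2 s1)).re ≤
      ∑ s1, ∑ s2, ∑ s3, ‖xw w s1 s2 s3‖ ^ 2 + ∑ s1, ∑ s2, ∑ s3, ‖xw u s1 s2 s3‖ ^ 2 := by
  have h1 := slice_one (w + u) (by
    intro r
    simp_rw [xw_add, mul_add, Finset.sum_add_distrib]
    rw [hw, hu, add_zero])
  have h2 := slice_one (w - u) (by
    intro r
    simp_rw [xw_sub, mul_sub, Finset.sum_sub_distrib]
    rw [hw, hu, sub_zero])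
  have h3 := (abs_le.1 h1).2
  have h4 := (abs_le.1 h2).1
  have e1 : (∑ s1, ∑ s2, ∑ s3, xw u s1 s2 s3 * (starRingEnd ℂ) (xw w s3 s2 s1)).re =
      (∑ s1, ∑ s2, ∑ s3, xw w s1 s2 s3 * (starRingEnd ℂ) (xw u s3 s2 s1)).re := by
    rw [← Complex.conj_re]
    congr 1
    simp_rw [map_sum, map_mul, Complex.conj_conj]
    rw [Finset.sum_comm]
    rw [Finset.sum_congr rfl (fun i _ => Finset.sum_comm)]
    rw [Finset.sum_comm]
    refine Finset.sum_congr rfl fun i _ => Finset.sum_congr rfl fun k _ =>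
      Finset.sum_congr rfl fun j _ => ?_
    ring
  have e2 : ∑ s1, ∑ s2, ∑ s3, ‖xw (w + u) s1 s2 s3‖ ^ 2 + ∑ s1, ∑ s2, ∑ s3, ‖xw (w - u) s1 s2 s3‖ ^ 2
      = 2 * (∑ s1, ∑ s2, ∑ s3, ‖xw w s1 s2 s3‖ ^ 2 + ∑ s1, ∑ s2, ∑ s3, ‖xw u s1 s2 s3‖ ^ 2) := by
    simp_rw [xw_add, xw_sub, ← Finset.sum_add_distrib, Finset.mul_sum]
    refine Finset.sum_congr rfl fun i _ => Finset.sum_congr rfl fun k _ =>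
      Finset.sum_congr rfl fun j _ => ?_
    have := parallelogram_law_with_norm ℝ (xw w i k j) (xw u i k j)
    nlinarith
  have e3 : (∑ s1, ∑ s2, ∑ s3, xw (w + u) s1 s2 s3 * (starRingEnd ℂ) (xw (w + u) s3 s2 s1)).re
    - (∑ s1, ∑ s2, ∑ s3, xw (w - u) s1 s2 s3 * (starRingEnd ℂ) (xw (w - u) s3 s2 s1)).re =
    2 * (∑ s1, ∑ s2, ∑ s3, xw w s1 s2 s3 * (starRingEnd ℂ) (xw u s3 s2 s1)).re +
    2 * (∑ s1, ∑ s2, ∑ s3, xw u s1 s2 s3 * (starRingEnd ℂ) (xw w s3 s2 s1)).re := by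
    simp_rw [Complex.re_sum, Finset.mul_sum, ← Finset.sum_sub_distrib, ← Finset.sum_add_distrib]
    refine Finset.sum_congr rfl fun i _ => Finset.sum_congr rfl fun k _ =>
      Finset.sum_congr rfl fun j _ => ?_
    simp only [xw_add, xw_sub, map_add, map_sub, Complex.mul_re, Complex.add_re, Complex.sub_re,
      Complex.add_im, Complex.sub_im]
    ring
  rw [e1] at e3
  linarith


section Knabe
variable {E : Type*} [NormedAddCommGroup E] [InnerProductSpace ℂ E] [FiniteDimensional ℂ E]

theorem spectral_le (S : E →ₗ[ℂ] E) (hS : S.IsSymmetric) (c : ℝ)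
    (h : ∀ (β : ℝ) (v : E), v ≠ 0 → S v = (β : ℂ) • v → c * β ≤ β ^ 2) (x : E) :
    c * (inner ℂ x (S x)).re ≤ ‖S x‖ ^ 2 := by
  set b := hS.eigenvectorBasis rfl
  have h1 : ∀ i, b.repr (S x) i = (hS.eigenvalues rfl i : ℂ) * b.repr x i :=
    fun i => hS.eigenvectorBasis_apply_self_apply rfl x i
  have h2 : (inner ℂ x (S x)).re = ∑ i, hS.eigenvalues rfl i * ‖b.repr x i‖ ^ 2 := by
    rw [← b.repr.inner_map_map, PiLp.inner_apply, Complex.re_sum]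
    refine Finset.sum_congr rfl fun i _ => ?_
    rw [h1, RCLike.inner_apply, mul_assoc, Complex.mul_conj, Complex.re_ofReal_mul,
      Complex.ofReal_re, Complex.normSq_eq_norm_sq]
  have h3 : ‖S x‖ ^ 2 = ∑ i, hS.eigenvalues rfl i ^ 2 * ‖b.repr x i‖ ^ 2 := by
    rw [← b.repr.norm_map, EuclideanSpace.norm_sq_eq]
    refine Finset.sum_congr rfl fun i _ => ?_
    rw [h1, norm_mul, mul_pow, Complex.norm_real, Real.norm_eq_abs, sq_abs]
  rw [h2, h3, Finset.mul_sum]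
  refine Finset.sum_le_sum fun i _ => ?_
  rw [← mul_assoc]
  refine mul_le_mul_of_nonneg_right ?_ (by positivity)
  refine h _ (b i) ?_ (hS.apply_eigenvectorBasis rfl i)
  exact b.orthonormal.ne_zero i

theorem spectral_contr (S : E →ₗ[ℂ] E) (hS : S.IsSymmetric) (c l : ℝ) (hl : 0 < l)
    (h : ∀ (β : ℝ) (v : E), v ≠ 0 → S v = (β : ℂ) • v → β = 0 ∨ (c ≤ β ∧ β ≤ l)) (x : E)
    (hx : ∀ v, S v = 0 → inner ℂ v x = 0) :
    ‖x - ((l⁻¹ : ℝ) : ℂ) • S x‖ ≤ |1 - c / l| * ‖x‖ := by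
  set b := hS.eigenvectorBasis rfl
  have h1 : ∀ i, b.repr (x - ((l⁻¹ : ℝ) : ℂ) • S x) i =
      ((1 - hS.eigenvalues rfl i / l : ℝ) : ℂ) * b.repr x i := by
    intro i
    have := hS.eigenvectorBasis_apply_self_apply rfl x i
    change b.repr (S x) i = _ at this
    rw [map_sub, map_smul, PiLp.sub_apply, PiLp.smul_apply, this, smul_eq_mul]
    push_cast
    simp only [b, RCLike.ofReal_eq_complex_ofReal]
    field_simp
  apply abs_le_of_sq_le_sq' _ (by positivity) |>.2
  rw [mul_pow, sq_abs, ← b.repr.norm_map, ← b.repr.norm_map x, EuclideanSpace.norm_sq_eq,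
    EuclideanSpace.norm_sq_eq, Finset.mul_sum]
  refine Finset.sum_le_sum fun i _ => ?_
  rw [h1, norm_mul, mul_pow, Complex.norm_real, Real.norm_eq_abs, sq_abs]
  have he := hS.apply_eigenvectorBasis rfl i
  rcases h (hS.eigenvalues rfl i) (b i) (b.orthonormal.ne_zero i) he with h0 | ⟨h0, h0'⟩
  · have : b.repr x i = 0 := by
      rw [b.repr_apply_apply]
      apply hx
      rw [he, h0]; simp
    rw [this]; simp
  · refine mul_le_mul_of_nonneg_right ?_ (by positivity)
    have : 0 ≤ 1 - hS.eigenvalues rfl i / l := by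
      rw [sub_nonneg, div_le_one hl]; exact h0'
    have h4 : 1 - hS.eigenvalues rfl i / l ≤ 1 - c / l := by
      gcongr
    nlinarith

/-- The complementary projection. -/
noncomputable def hp (A : Submodule ℂ E) : E →ₗ[ℂ] E := LinearMap.id - A.starProjection.toLinearMap

theorem hp_apply (A : Submodule ℂ E) (x : E) : hp A x = x - A.starProjection x := rfl

theorem hp_symm (A : Submodule ℂ E) : (hp A).IsSymmetric :=
  LinearMap.IsSymmetric.sub LinearMap.IsSymmetric.id A.starProjection_isSymmetric

theorem hp_idem (A : Submodule ℂ E) (x : E) : hp A (hp A x) = hp A x := by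
  simp only [hp_apply, map_sub]
  rw [Submodule.starProjection_eq_self_iff.2 (A.starProjection_apply_mem x)]
  simp

theorem hp_inner (A : Submodule ℂ E) (x : E) : (inner ℂ x (hp A x)).re = ‖hp A x‖ ^ 2 := by
  rw [← hp_idem, ← hp_symm A, ← inner_self_eq_norm_sq (𝕜 := ℂ)]
  rw [hp_idem]
  rfl

theorem hp_eq_zero (A : Submodule ℂ E) (x : E) : hp A x = 0 ↔ x ∈ A := by
  rw [hp_apply, sub_eq_zero, eq_comm, Submodule.starProjection_eq_self_iff]

theorem hp_norm_le (A : Submodule ℂ E) (x : E) : ‖hp A x‖ ≤ ‖x‖ := by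
  have h1 := hp_inner A x
  have h2 := (Complex.re_le_norm _).trans (norm_inner_le_norm (𝕜 := ℂ) x (hp A x))
  rw [h1] at h2
  rcases (norm_nonneg (hp A x)).eq_or_lt with h | h
  · rw [← h]; exact norm_nonneg _
  · nlinarith

theorem pair_bound (A B : Submodule ℂ E)
    (hadj : ∀ x ∈ A, ∀ y ∈ B, (∀ z ∈ A ⊓ B, inner ℂ z x = 0) → (∀ z ∈ A ⊓ B, inner ℂ z y = 0) →
      5 * (inner ℂ x y).re ≤ ‖x‖ ^ 2 + ‖y‖ ^ 2) (x : E) :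
    -(1 / 5) * (‖hp A x‖ ^ 2 + ‖hp B x‖ ^ 2) ≤ (inner ℂ (hp A x) (hp B x)).re := by
  have hs : (hp A + hp B).IsSymmetric := (hp_symm A).add (hp_symm B)
  have key := spectral_le (hp A + hp B) hs (3 / 5) (by
    intro β v hv hβ
    by_cases h0 : β = 0
    · simp [h0]
    have hpos : 0 ≤ β := by
      have : (inner ℂ v ((hp A + hp B) v)).re = β * ‖v‖ ^ 2 := by
        rw [hβ, inner_smul_right, Complex.re_ofReal_mul, ← inner_self_eq_norm_sq (𝕜 := ℂ)]; rfl
      rw [LinearMap.add_apply, inner_add_right, Complex.add_re, hp_inner, hp_inner] at this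
      have hv' : 0 < ‖v‖ ^ 2 := by positivity
      by_contra hneg
      nlinarith [sq_nonneg ‖hp A v‖, sq_nonneg ‖hp B v‖]
    suffices 3 / 5 ≤ β by nlinarith
    have hperp : ∀ z ∈ A ⊓ B, inner ℂ z v = 0 := by
      intro z hz
      have h1 : inner ℂ ((hp A + hp B) z) v = inner ℂ z ((hp A + hp B) v) := hs z v
      rw [hβ, LinearMap.add_apply, (hp_eq_zero A z).2 hz.1, (hp_eq_zero B z).2 hz.2, inner_smul_right,
        add_zero, inner_zero_left] at h1
      rcases mul_eq_zero.1 h1.symm with h | h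
      · exact absurd (by exact_mod_cast h) h0
      · exact h
    set p := A.starProjection v with hp'
    set q := B.starProjection v with hq'
    have hpm : p ∈ A := A.starProjection_apply_mem v
    have hqm : q ∈ B := B.starProjection_apply_mem v
    have hb := hadj p hpm q hqm
      (fun z hz => by
        rw [hp', ← A.inner_starProjection_left_eq_right, Submodule.starProjection_eq_self_iff.2 hz.1]
        exact hperp z hz)
      (fun z hz => by
        rw [hq', ← B.inner_starProjection_left_eq_right, Submodule.starProjection_eq_self_iff.2 hz.2]
        exact hperp z hz)
    have hpq : p + q = ((2 - β : ℝ) : ℂ) • v := by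
      rw [LinearMap.add_apply, hp_apply, hp_apply] at hβ
      have : p + q = (2 : ℂ) • v - (β : ℂ) • v := by
        rw [← hβ, two_smul]; abel
      rw [this, ← sub_smul]; push_cast; rfl
    have ep : (inner ℂ p v).re = ‖p‖ ^ 2 := by
      have := A.inner_starProjection_left_eq_right v p
      rw [Submodule.starProjection_eq_self_iff.2 hpm] at this
      rw [← inner_self_eq_norm_sq (𝕜 := ℂ), hp', this, ← inner_conj_symm, Complex.conj_re]
      rfl
    have eq : (inner ℂ q v).re = ‖q‖ ^ 2 := by
      have := B.inner_starProjection_left_eq_right v q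
      rw [Submodule.starProjection_eq_self_iff.2 hqm] at this
      rw [← inner_self_eq_norm_sq (𝕜 := ℂ), hq', this, ← inner_conj_symm, Complex.conj_re]
      rfl
    have e1 : ‖p‖ ^ 2 + (inner ℂ p q).re = (2 - β) * ‖p‖ ^ 2 := by
      have : (inner ℂ p (p + q)).re = (2 - β) * ‖p‖ ^ 2 := by
        rw [hpq, inner_smul_right, Complex.re_ofReal_mul, ep]
      rw [← this, inner_add_right, Complex.add_re, ← inner_self_eq_norm_sq (𝕜 := ℂ)]; rfl
    have e2 : ‖q‖ ^ 2 + (inner ℂ p q).re = (2 - β) * ‖q‖ ^ 2 := by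
      have : (inner ℂ q (p + q)).re = (2 - β) * ‖q‖ ^ 2 := by
        rw [hpq, inner_smul_right, Complex.re_ofReal_mul, eq]
      rw [← this, inner_add_right, Complex.add_re, ← inner_self_eq_norm_sq (𝕜 := ℂ),
        ← inner_conj_symm q p, Complex.conj_re, add_comm]; rfl
    by_contra hlt
    push Not at hlt
    have hz : ‖p‖ ^ 2 + ‖q‖ ^ 2 ≤ 0 := by
      nlinarith [sq_nonneg ‖p‖, sq_nonneg ‖q‖]
    have hp0 : p = 0 := by
      have : ‖p‖ ^ 2 = 0 := by nlinarith [sq_nonneg ‖p‖, sq_nonneg ‖q‖]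
      simpa using this
    have hq0 : q = 0 := by
      have : ‖q‖ ^ 2 = 0 := by nlinarith [sq_nonneg ‖p‖, sq_nonneg ‖q‖]
      simpa using this
    rw [hp0, hq0, add_zero] at hpq
    rcases smul_eq_zero.1 hpq.symm with h | h
    · have : (2 - β : ℝ) = 0 := by exact_mod_cast h
      linarith
    · exact hv h) x
  rw [LinearMap.add_apply, inner_add_right, Complex.add_re, hp_inner, hp_inner] at key
  have := norm_add_sq (𝕜 := ℂ) (hp A x) (hp B x)
  rw [this] at key
  change _ ≤ _ + 2 * (inner ℂ (hp A x) (hp B x)).re + _ at key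
  linarith

theorem comm_bound (A B : Submodule ℂ E) (h : ∀ x ∈ B, A.starProjection x ∈ B) (x : E) :
    0 ≤ (inner ℂ (hp A x) (hp B x)).re := by
  have hAB : ∀ y ∈ Bᗮ, A.starProjection y ∈ Bᗮ := by
    intro y hy
    rw [Submodule.mem_orthogonal] at hy ⊢
    intro u hu
    rw [← A.inner_starProjection_left_eq_right]
    exact hy _ (h u hu)
  have hm : hp B x ∈ Bᗮ := B.sub_starProjection_mem_orthogonal x
  -- hp A (hp B x) ∈ Bᗮ
  have hm2 : hp A (hp B x) ∈ Bᗮ := by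
    rw [hp_apply A]; exact Submodule.sub_mem _ hm (hAB _ hm)
  have e : inner ℂ (hp A x) (hp B x) = inner ℂ (hp A (hp B x)) (hp A (hp B x)) := by
    have h1 : inner ℂ (hp A x) (hp B x) = inner ℂ x (hp A (hp B x)) := hp_symm A _ _
    have h2 : inner ℂ (hp A (hp B x)) (hp A (hp B x)) = inner ℂ (hp B x) (hp A (hp A (hp B x))) :=
      hp_symm A _ _
    rw [h1, h2, hp_idem]
    generalize hp A (hp B x) = Z at hm2
    rw [hp_apply B x, inner_sub_left]
    rw [(Submodule.mem_orthogonal _ _).1 hm2 _ (B.starProjection_apply_mem x), sub_zero]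
  rw [e]
  exact inner_self_nonneg (𝕜 := ℂ)

theorem knabe (n : ℕ) [NeZero n] (hn : 3 ≤ n) (F : ZMod n → Submodule ℂ E)
    (hadj : ∀ i, ∀ x ∈ F i, ∀ y ∈ F (i + 1), (∀ z ∈ F i ⊓ F (i + 1), inner ℂ z x = 0) →
      (∀ z ∈ F i ⊓ F (i + 1), inner ℂ z y = 0) → 5 * (inner ℂ x y).re ≤ ‖x‖ ^ 2 + ‖y‖ ^ 2)
    (hcomm : ∀ i j, j ≠ i → j ≠ i + 1 → i ≠ j + 1 → ∀ x ∈ F j, (F i).starProjection x ∈ F j)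
    (T : E → E) (hT : ∀ x, T x = ((n : ℂ)⁻¹) • ∑ i, (F i).starProjection x)
    (k : ℕ) (x : E) :
    ‖T^[k] x - (⨅ i, F i).starProjection x‖ ≤ (1 - 1 / (5 * (n : ℝ))) ^ k * ‖x‖ := by
  have hn0 : (0 : ℝ) < n := by positivity
  set H : E →ₗ[ℂ] E := ∑ i, hp (F i) with hH
  have hHs : H.IsSymmetric := by
    intro x y
    simp only [hH, LinearMap.sum_apply, sum_inner, inner_sum]
    exact Finset.sum_congr rfl fun i _ => hp_symm (F i) x y
  have hHin : ∀ x, (inner ℂ x (H x)).re = ∑ i, ‖hp (F i) x‖ ^ 2 := by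
    intro x
    simp only [hH, LinearMap.sum_apply, inner_sum, Complex.re_sum, hp_inner]
  have hker : ∀ x, H x = 0 ↔ x ∈ ⨅ i, F i := by
    intro x
    constructor
    · intro h
      have h1 := hHin x
      rw [h, inner_zero_right, Complex.zero_re] at h1
      have h2 := (Finset.sum_eq_zero_iff_of_nonneg (fun i _ => sq_nonneg ‖hp (F i) x‖)).1 h1.symm
      rw [Submodule.mem_iInf]
      intro i
      have := h2 i (Finset.mem_univ i)
      rw [← hp_eq_zero]
      simpa using this
    · intro h
      rw [Submodule.mem_iInf] at h
      simp only [hH, LinearMap.sum_apply]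
      exact Finset.sum_eq_zero fun i _ => (hp_eq_zero _ _).2 (h i)
  have hTH : ∀ x, T x = x - (((n : ℝ)⁻¹ : ℝ) : ℂ) • H x := by
    intro x
    rw [hT]
    simp only [hH, LinearMap.sum_apply, hp_apply, Finset.sum_sub_distrib, Finset.sum_const,
      Finset.card_univ, ZMod.card, smul_sub]
    rw [← Nat.cast_smul_eq_nsmul ℂ, smul_smul]
    push_cast
    rw [inv_mul_cancel₀ (by exact_mod_cast hn0.ne'), one_smul]
    abel
  -- Knabe
  have hsq : ∀ v, (1 / 5) * ∑ i, ‖hp (F i) v‖ ^ 2 ≤ ‖H v‖ ^ 2 := by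
    intro v
    have e : ‖H v‖ ^ 2 = ∑ i, ∑ j, (inner ℂ (hp (F i) v) (hp (F j) v)).re := by
      rw [← inner_self_eq_norm_sq (𝕜 := ℂ)]
      simp only [hH, LinearMap.sum_apply, sum_inner, inner_sum]
      simp [Complex.re_sum]
      rw [Finset.sum_comm]
    set t : ZMod n → ZMod n → ℝ := fun i j => (inner ℂ (hp (F i) v) (hp (F j) v)).re with ht
    have h1 : ∀ i : ZMod n, t i i + t i (i + 1) + t i (i - 1) ≤ ∑ j, t i j := by
      intro i
      haveI : Fact (1 < n) := ⟨by omega⟩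
      have a1 : i ≠ i + 1 := by simp
      have a2 : i ≠ i - 1 := by
        intro h; have : (1 : ZMod n) = 0 := by linear_combination h
        exact one_ne_zero this
      have a3 : i + 1 ≠ i - 1 := by
        intro h
        have : ((2 : ℕ) : ZMod n) = 0 := by push_cast; linear_combination h
        rw [ZMod.natCast_eq_zero_iff] at this
        have := Nat.le_of_dvd (by norm_num) this
        omega
      have : t i i + t i (i + 1) + t i (i - 1) = ∑ j ∈ ({i, i + 1, i - 1} : Finset (ZMod n)), t i j := by
        rw [Finset.sum_insert (by simp [a1, a2]), Finset.sum_insert (by simp [a3]),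
          Finset.sum_singleton, add_assoc]
      rw [this]
      refine Finset.sum_le_sum_of_subset_of_nonneg (Finset.subset_univ _) ?_
      intro j _ hj
      simp only [Finset.mem_insert, Finset.mem_singleton, not_or] at hj
      refine comm_bound _ _ (hcomm i j hj.1 hj.2.1 ?_) v
      intro h
      exact hj.2.2 (by rw [h]; ring)
    have h2 : ∀ i, t i i = ‖hp (F i) v‖ ^ 2 := by
      intro i
      rw [ht, ← inner_self_eq_norm_sq (𝕜 := ℂ)]; rfl
    have h3 : ∀ i, -(1 / 5) * (t i i + t (i + 1) (i + 1)) ≤ t i (i + 1) := by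
      intro i
      rw [h2, h2]
      exact pair_bound _ _ (hadj i) v
    have h4 : ∀ i j, t i j = t j i := by
      intro i j
      simp only [ht]
      rw [← inner_conj_symm, Complex.conj_re]
    have s1 : ∑ i, t i (i - 1) = ∑ i, t i (i + 1) := by
      rw [← Equiv.sum_comp (Equiv.addRight (1 : ZMod n)) (fun i => t i (i - 1))]
      refine Finset.sum_congr rfl fun i _ => ?_
      simp only [Equiv.coe_addRight, add_sub_cancel_right]
      exact h4 _ _
    have s2 : ∑ i : ZMod n, t (i + 1) (i + 1) = ∑ i, t i i :=
      Equiv.sum_comp (Equiv.addRight (1 : ZMod n)) (fun i => t i i)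
    have s3 := Finset.sum_le_sum (s := Finset.univ) (fun i _ => h1 i)
    have s4 := Finset.sum_le_sum (s := Finset.univ) (fun i _ => h3 i)
    rw [← Finset.mul_sum] at s4
    simp only [Finset.sum_add_distrib] at s3 s4
    rw [s1] at s3
    rw [s2] at s4
    rw [e]
    simp_rw [← h2]
    change _ ≤ ∑ i, ∑ j, t i j
    linarith
  have hev : ∀ (β : ℝ) (v : E), v ≠ 0 → H v = (β : ℂ) • v → β = 0 ∨ (1 / 5 ≤ β ∧ β ≤ n) := by
    intro β v hv hβ
    have h1 := hHin v
    have h2 := hsq v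
    have hv' : 0 < ‖v‖ ^ 2 := by positivity
    have e1 : (inner ℂ v (H v)).re = β * ‖v‖ ^ 2 := by
      rw [hβ, inner_smul_right, Complex.re_ofReal_mul, ← inner_self_eq_norm_sq (𝕜 := ℂ)]; rfl
    rw [← h1, e1, hβ, norm_smul, Complex.norm_real, Real.norm_eq_abs, mul_pow, sq_abs] at h2
    have h3 : 0 ≤ β * ‖v‖ ^ 2 := by
      rw [← e1, h1]; positivity
    have h4 : β * ‖v‖ ^ 2 ≤ n * ‖v‖ ^ 2 := by
      rw [← e1, h1]
      calc ∑ i, ‖hp (F i) v‖ ^ 2 ≤ ∑ i : ZMod n, ‖v‖ ^ 2 :=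
            Finset.sum_le_sum fun i _ => pow_le_pow_left₀ (norm_nonneg _) (hp_norm_le _ _) 2
        _ = _ := by simp
    have h5 : 0 ≤ β := nonneg_of_mul_nonneg_left h3 hv'
    have h6 : β ≤ n := le_of_mul_le_mul_right h4 hv'
    rw [← mul_assoc] at h2
    have h7 : 1 / 5 * β ≤ β ^ 2 := le_of_mul_le_mul_right h2 hv'
    rcases h5.eq_or_lt with h | h
    · exact Or.inl h.symm
    · refine Or.inr ⟨?_, h6⟩
      nlinarith
  have hlam : 1 - (1 / 5) / (n : ℝ) = 1 - 1 / (5 * (n : ℝ)) := by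
    field_simp
  have hlam0 : 0 ≤ 1 - 1 / (5 * (n : ℝ)) := by
    have : (3 : ℝ) ≤ n := by exact_mod_cast hn
    rw [sub_nonneg, div_le_one (by positivity)]
    linarith
  have hcontr : ∀ y, (∀ v, H v = 0 → inner ℂ v y = 0) →
      ‖T y‖ ≤ (1 - 1 / (5 * (n : ℝ))) * ‖y‖ := by
    intro y hy
    have := spectral_contr H hHs (1 / 5) n hn0 hev y hy
    rw [hlam, abs_of_nonneg hlam0, ← hTH] at this
    exact this
  set P := (⨅ i, F i).starProjection
  have hiter : ∀ k, (∀ v, H v = 0 → inner ℂ v (T^[k] x - P x) = 0) ∧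
      ‖T^[k] x - P x‖ ≤ (1 - 1 / (5 * (n : ℝ))) ^ k * ‖x - P x‖ := by
    intro k
    induction k with
    | zero =>
      refine ⟨?_, by simp⟩
      intro v hv
      exact (Submodule.mem_orthogonal _ _).1 ((⨅ i, F i).sub_starProjection_mem_orthogonal x) v
        ((hker v).1 hv)
    | succ k ih =>
      have e : T^[k + 1] x - P x = T (T^[k] x - P x) := by
        rw [Function.iterate_succ_apply', hTH, hTH, map_sub,
          (hker (P x)).2 ((⨅ i, F i).starProjection_apply_mem x), sub_zero]
        abel
      rw [e]
      refine ⟨?_, ?_⟩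
      · intro v hv
        rw [hTH, inner_sub_right, ih.1 v hv, inner_smul_right, ← hHs, hv, inner_zero_left]
        simp
      · refine (hcontr _ ih.1).trans ?_
        rw [pow_succ', mul_assoc]
        exact mul_le_mul_of_nonneg_left ih.2 hlam0
  refine (hiter k).2.trans ?_
  refine mul_le_mul_of_nonneg_left ?_ (by positivity)
  exact hp_norm_le (⨅ i, F i) x

end Knabe


section SchurWeyl
variable {α : Type*} [Fintype α] [DecidableEq α]

theorem tensorPow_mul (t : ℕ) (A B : Matrix α α ℂ) :
    tensorPow t (A * B) = tensorPow t A * tensorPow t B := by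
  ext x y
  simp only [tensorPow, Matrix.mul_apply]
  rw [Finset.prod_univ_sum, Fintype.piFinset_univ]
  exact Finset.sum_congr rfl fun c _ => Finset.prod_mul_distrib

theorem tensorPow_one (t : ℕ) : tensorPow t (1 : Matrix α α ℂ) = 1 := by
  ext x y
  simp only [tensorPow, Matrix.one_apply]
  rw [Finset.prod_ite_zero]
  simp [funext_iff]

theorem tensorPow_conjTranspose (t : ℕ) (A : Matrix α α ℂ) :
    tensorPow t Aᴴ = (tensorPow t A)ᴴ := by
  ext x y
  simp [tensorPow, Matrix.conjTranspose_apply]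

theorem tensorPow_unitary (t : ℕ) {U : Matrix α α ℂ} (hU : U ∈ Matrix.unitaryGroup α ℂ) :
    tensorPow t U ∈ Matrix.unitaryGroup (Fin t → α) ℂ := by
  rw [Matrix.mem_unitaryGroup_iff] at hU ⊢
  rw [Matrix.star_eq_conjTranspose] at hU ⊢
  rw [← tensorPow_conjTranspose, ← tensorPow_mul, hU, tensorPow_one]

/-- Permutation operator on three tensor factors. -/
def permOp (π : Equiv.Perm (Fin 3)) : Matrix (Fin 3 → α) (Fin 3 → α) ℂ :=
  fun b b' => if ∀ a, b a = b' (π a) then 1 else 0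

theorem permOp_comm (π : Equiv.Perm (Fin 3)) (A : Matrix α α ℂ) :
    tensorPow 3 A * permOp π = permOp π * tensorPow 3 A := by
  ext x y
  simp only [Matrix.mul_apply, permOp]
  have h1 : ∀ c : Fin 3 → α, (∀ a, c a = y (π a)) ↔ c = fun a => y (π a) := fun c =>
    ⟨fun h => funext h, fun h a => by rw [h]⟩
  have h2 : ∀ c : Fin 3 → α, (∀ a, x a = c (π a)) ↔ c = fun a => x (π.symm a) := fun c =>
    ⟨fun h => funext fun a => by rw [h]; simp, fun h a => by rw [h]; simp⟩
  simp only [h1, h2]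
  simp only [mul_ite, mul_one, mul_zero, ite_mul, one_mul, zero_mul, Finset.sum_ite_eq',
    Finset.mem_univ, if_true, tensorPow]
  rw [← Equiv.prod_comp π (fun i => A (x (π.symm i)) (y i))]
  exact Finset.prod_congr rfl fun a _ => by rw [Equiv.symm_apply_apply]

theorem diag_unit (j : α) :
    Matrix.diagonal (fun x => if x = j then Complex.I else 1) ∈ Matrix.unitaryGroup α ℂ := by
  rw [Matrix.mem_unitaryGroup_iff, Matrix.star_eq_conjTranspose, Matrix.diagonal_conjTranspose,
    Matrix.diagonal_mul_diagonal, ← Matrix.diagonal_one]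
  congr 1
  ext x
  by_cases h : x = j <;> simp [h]

theorem perm_unit (τ : Equiv.Perm α) :
    Matrix.of (fun x y => if x = τ y then (1 : ℂ) else 0) ∈ Matrix.unitaryGroup α ℂ := by
  rw [Matrix.mem_unitaryGroup_iff, Matrix.star_eq_conjTranspose]
  ext x y
  rw [Matrix.mul_apply]
  simp only [Matrix.conjTranspose_apply, Matrix.of_apply]
  rw [← Equiv.sum_comp τ.symm]
  simp [Matrix.one_apply, eq_comm]

/-- A rational rotation in the plane of two letters. -/
noncomputable def rotM (q r : α) : Matrix α α ℂ := fun x y =>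
  if x = q then ((if y = q then 3/5 else 0) + (if y = r then 4/5 else 0))
  else if x = r then ((if y = q then -4/5 else 0) + (if y = r then 3/5 else 0))
  else if y = x then 1 else 0

theorem rot_unit (q r : α) (hqr : q ≠ r) : rotM q r ∈ Matrix.unitaryGroup α ℂ := by
  rw [Matrix.mem_unitaryGroup_iff, Matrix.star_eq_conjTranspose]
  ext x y
  rw [Matrix.mul_apply]
  simp only [Matrix.conjTranspose_apply, rotM, Matrix.one_apply]
  have hrq := hqr.symm
  have c3 : (starRingEnd ℂ) 3 = 3 := Complex.conj_ofNat 3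
  have c4 : (starRingEnd ℂ) 4 = 4 := Complex.conj_ofNat 4
  have c5 : (starRingEnd ℂ) 5 = 5 := Complex.conj_ofNat 5
  by_cases hx : x = q
  · subst hx
    by_cases hy : y = x
    · subst hy
      simp [mul_add, add_mul, Finset.sum_add_distrib, apply_ite (starRingEnd ℂ), hqr, hrq, c3, c4, c5]
      norm_num
    · by_cases hy' : y = r
      · subst hy'
        simp [mul_add, add_mul, Finset.sum_add_distrib, apply_ite (starRingEnd ℂ), hqr, hrq, c3, c4, c5]
        norm_num
      · simp [mul_add, add_mul, Finset.sum_add_distrib, apply_ite (starRingEnd ℂ), hqr, hrq, hy, hy', c3, c4, c5,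
          Ne.symm hy, Ne.symm hy']
  · by_cases hx' : x = r
    · subst hx'
      by_cases hy : y = q
      · subst hy
        simp [mul_add, add_mul, Finset.sum_add_distrib, apply_ite (starRingEnd ℂ), hqr, hrq, c3, c4, c5]
        norm_num
      · by_cases hy' : y = x
        · subst hy'
          simp [mul_add, add_mul, Finset.sum_add_distrib, apply_ite (starRingEnd ℂ), hqr, hrq, c3, c4, c5]
          norm_num
        · simp [mul_add, add_mul, Finset.sum_add_distrib, apply_ite (starRingEnd ℂ), hqr, hrq, hy, hy', c3, c4, c5,
            Ne.symm hy, Ne.symm hy']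
    · by_cases hy : y = q
      · subst hy
        simp [hx, hx', Ne.symm hx, Ne.symm hx']
      · by_cases hy' : y = r
        · subst hy'
          simp [hx, hx', Ne.symm hx, Ne.symm hx']
        · simp [hx, hx', hy, hy', eq_comm]

theorem sum_fin3 (g : (Fin 3 → α) → ℂ) : ∑ c, g c = ∑ x, ∑ y, ∑ z, g ![x, y, z] := by
  rw [← Fintype.sum_prod_type', ← Fintype.sum_prod_type']
  refine Fintype.sum_equiv ⟨fun c => ((c 0, c 1), c 2), fun p => ![p.1.1, p.1.2, p.2], ?_, ?_⟩ _ _ ?_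
  · intro c; ext i; fin_cases i <;> rfl
  · intro p; rfl
  · intro c
    congr 1
    ext i; fin_cases i <;> rfl

set_option maxHeartbeats 2000000 in
theorem sw_zero (D : Matrix (Fin 3 → α) (Fin 3 → α) ℂ)
    (hD : ∀ U ∈ Matrix.unitaryGroup α ℂ, tensorPow 3 U * D = D * tensorPow 3 U)
    (e : Fin 3 → α) (he : Function.Injective e) 
    (h0 : ∀ π : Equiv.Perm (Fin 3), D e (fun a => e (π.symm a)) = 0) : D = 0 := by
  have hcont : ∀ b b', D b b' ≠ 0 → ∀ j, (Finset.univ.filter fun a => b a = j).card =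
      (Finset.univ.filter fun a => b' a = j).card := by
    intro b b' hb j
    have := congrFun (congrFun (hD _ (diag_unit j)) b) b'
    rw [Matrix.mul_apply, Matrix.mul_apply] at this
    have ht : ∀ x y, tensorPow 3 (Matrix.diagonal (fun x => if x = j then Complex.I else 1)) x y =
        if x = y then Complex.I ^ (Finset.univ.filter fun a => x a = j).card else 0 := by
      intro x y
      simp only [tensorPow, Matrix.diagonal_apply]
      rw [Finset.prod_ite_zero]
      simp [funext_iff, Finset.prod_ite]
    simp only [ht] at this
    simp only [mul_ite, ite_mul, zero_mul, mul_zero, Finset.sum_ite_eq, Finset.sum_ite_eq',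
      Finset.mem_univ, if_true] at this
    rw [mul_comm] at this
    have h2 := mul_left_cancel₀ hb this
    have b1 := Finset.card_filter_le (Finset.univ : Finset (Fin 3)) (fun a => b a = j)
    have b2 := Finset.card_filter_le (Finset.univ : Finset (Fin 3)) (fun a => b' a = j)
    simp only [Finset.card_univ, Fintype.card_fin] at b1 b2
    generalize (Finset.univ.filter fun a => b a = j).card = m at *
    generalize (Finset.univ.filter fun a => b' a = j).card = m' at *
    interval_cases m <;> interval_cases m' <;> first | rfl | (exfalso; revert h2; simp [pow_succ, Complex.ext_iff]; try norm_num)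
  have hperm : ∀ (τ : Equiv.Perm α) b b', D (fun a => τ (b a)) (fun a => τ (b' a)) = D b b' := by
    intro τ b b'
    have := congrFun (congrFun (hD _ (perm_unit τ)) (fun a => τ (b a))) b'
    rw [Matrix.mul_apply, Matrix.mul_apply] at this
    simp only [tensorPow, Matrix.of_apply, Finset.prod_ite_zero, Finset.prod_const_one, Finset.mem_univ, 
      forall_true_left] at this
    have h1 : ∀ c : Fin 3 → α, (∀ a, τ (b a) = τ (c a)) ↔ b = c := fun c =>
      ⟨fun h => funext fun a => τ.injective (h a), fun h a => by rw [h]⟩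
    have h2 : ∀ c : Fin 3 → α, (∀ a, c a = τ (b' a)) ↔ c = fun a => τ (b' a) := fun c =>
      ⟨fun h => funext h, fun h a => by rw [h]⟩
    simp only [h1, h2] at this
    simpa using this.symm
  have hinj : ∀ b, Function.Injective b → ∀ b', D b b' = 0 := by
    intro b hb b'
    by_contra hne
    have hc := hcont b b' hne
    have : ∀ a, ∃ a', b' a' = b a := by
      intro a
      have h1 := hc (b a)
      have h2 : 0 < (Finset.univ.filter fun a' => b a' = b a).card :=
        Finset.card_pos.2 ⟨a, by simp⟩
      rw [h1, Finset.card_pos] at h2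
      obtain ⟨x, hx⟩ := h2
      exact ⟨x, by simpa using hx⟩
    choose f hf using this
    have fi : Function.Injective f := fun x y hxy => hb (by rw [← hf, ← hf, hxy])
    let π := Equiv.ofBijective f (Finite.injective_iff_bijective.1 fi)
    obtain ⟨τ, hτ⟩ : ∃ τ : Equiv.Perm α, ∀ a, τ (e a) = b a := by
      let E1 := Equiv.ofInjective e he
      let E2 := Equiv.ofInjective b hb
      refine ⟨(E1.symm.trans E2).extendSubtype, fun a => ?_⟩
      have := Equiv.extendSubtype_apply_of_mem (E1.symm.trans E2) (e a) ⟨a, rfl⟩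
      rw [this]
      have h3 : E1.symm ⟨e a, ⟨a, rfl⟩⟩ = a := Equiv.ofInjective_symm_apply he a
      change ((E2 (E1.symm ⟨e a, _⟩)) : α) = _
      rw [h3]; rfl
    apply hne
    have := hperm τ e (fun a => e (π.symm a))
    rw [h0] at this
    rw [← this]
    congr 1
    · ext a; rw [hτ]
    · ext a; rw [hτ]
      have : f (π.symm a) = a := π.apply_symm_apply a
      rw [← hf, this]
  have hrow : ∀ q r, q ≠ r → ∀ b, (∀ b', D b b' = 0) → ∀ b',
      ∑ x, ∑ y, ∑ z, rotM q r (b 0) x * rotM q r (b 1) y * rotM q r (b 2) z * D ![x, y, z] b' = 0 := by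
    intro q r hqr b hb b'
    have := congrFun (congrFun (hD _ (rot_unit q r hqr)) b) b'
    rw [Matrix.mul_apply, Matrix.mul_apply] at this
    simp only [hb, zero_mul, Finset.sum_const_zero] at this
    rw [sum_fin3] at this
    simpa [tensorPow, Fin.prod_univ_three] using this
  have rq : ∀ q r : α, q ≠ r → ∀ y, rotM q r q y = (if y = q then 3/5 else 0) + (if y = r then 4/5 else 0) := by
    intro q r _ y; simp [rotM]
  have rr : ∀ q r : α, q ≠ r → ∀ y, rotM q r r y = (if y = q then -4/5 else 0) + (if y = r then 3/5 else 0) := by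
    intro q r h y; simp [rotM, h.symm]
  have rp : ∀ p q r : α, p ≠ q → p ≠ r → ∀ y, rotM q r p y = (if y = p then 1 else 0) := by
    intro p q r h h' y; simp [rotM, h, h']
  have inj3 : ∀ p q r : α, p ≠ q → p ≠ r → q ≠ r → Function.Injective ![p, q, r] := by
    intro p q r h1 h2 h3 i j hij
    fin_cases i <;> fin_cases j <;> simp_all [eq_comm]
  have hthird : ∀ p q : α, ∃ r, p ≠ r ∧ q ≠ r := by
    intro p q
    by_contra! h
    have h3 : ∀ a, e a = p ∨ e a = q := fun a => by
      by_cases h1 : p = e a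
      · exact Or.inl h1.symm
      · exact Or.inr (h _ h1).symm
    have n01 : e 0 ≠ e 1 := fun h => by simpa using he h
    have n02 : e 0 ≠ e 2 := fun h => by simpa using he h
    have n12 : e 1 ≠ e 2 := fun h => by simpa using he h
    rcases h3 0 with h0 | h0 <;> rcases h3 1 with h1 | h1 <;> rcases h3 2 with h2 | h2 <;>
      first
        | exact n01 (h0.trans h1.symm)
        | exact n02 (h0.trans h2.symm)
        | exact n12 (h1.trans h2.symm)
  have hdiff : ∀ b c b' j, (Finset.univ.filter fun a => b a = j).card ≠
      (Finset.univ.filter fun a => c a = j).card → ∀ s t : ℂ, s ≠ 0 → s * D b b' + t * D c b' = 0 →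
      D b b' = 0 := by
    intro b c b' j hj s t hs h
    by_contra hne
    have : D c b' = 0 := by
      by_contra hne2
      exact hj ((hcont b b' hne j).trans (hcont c b' hne2 j).symm)
    rw [this, mul_zero, add_zero] at h
    exact hne ((mul_eq_zero.1 h).resolve_left hs)
  have hA : ∀ p q, p ≠ q → ∀ b', D ![p, q, q] b' = 0 := by
    intro p q hpq b'
    obtain ⟨r, hpr, hqr⟩ := hthird p q
    have h := hrow q r hqr ![p, q, r] (hinj _ (inj3 _ _ _ hpq hpr hqr)) b'
    have e1 := hinj _ (inj3 p q r hpq hpr hqr) b'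
    have e2 := hinj _ (inj3 p r q hpr hpq hqr.symm) b'
    simp [rq q r hqr, rr q r hqr, rp p q r hpq hpr, add_mul, mul_add, Finset.sum_add_distrib, e1, e2] at h
    refine hdiff ![p, q, q] ![p, r, r] b' q ?_ (3/5 * (-4/5)) (4/5 * (3/5)) (by norm_num) (by linear_combination h)
    rw [Finset.card_filter, Finset.card_filter, Fin.sum_univ_three, Fin.sum_univ_three]
    simp [hpq, hqr.symm]
  have hB : ∀ p q, p ≠ q → ∀ b', D ![q, p, q] b' = 0 := by
    intro p q hpq b'
    obtain ⟨r, hpr, hqr⟩ := hthird p q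
    have h := hrow q r hqr ![q, p, r] (hinj _ (inj3 _ _ _ hpq.symm hqr hpr)) b'
    have e1 := hinj _ (inj3 q p r hpq.symm hqr hpr) b'
    have e2 := hinj _ (inj3 r p q hpr.symm hqr.symm hpq) b'
    simp [rq q r hqr, rr q r hqr, rp p q r hpq hpr, add_mul, mul_add, Finset.sum_add_distrib, e1, e2] at h
    refine hdiff ![q, p, q] ![r, p, r] b' q ?_ (3/5 * (-4/5)) (4/5 * (3/5)) (by norm_num) (by linear_combination h)
    rw [Finset.card_filter, Finset.card_filter, Fin.sum_univ_three, Fin.sum_univ_three]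
    simp [hpq, hqr.symm]
  have hC : ∀ p q, p ≠ q → ∀ b', D ![q, q, p] b' = 0 := by
    intro p q hpq b'
    obtain ⟨r, hpr, hqr⟩ := hthird p q
    have h := hrow q r hqr ![q, r, p] (hinj _ (inj3 _ _ _ hqr hpq.symm hpr.symm)) b'
    have e1 := hinj _ (inj3 q r p hqr hpq.symm hpr.symm) b'
    have e2 := hinj _ (inj3 r q p hqr.symm hpr.symm hpq.symm) b'
    simp [rq q r hqr, rr q r hqr, rp p q r hpq hpr, add_mul, mul_add, Finset.sum_add_distrib, e1, e2] at h
    refine hdiff ![q, q, p] ![r, r, p] b' q ?_ (3/5 * (-4/5)) (4/5 * (3/5)) (by norm_num) (by linear_combination h)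
    rw [Finset.card_filter, Finset.card_filter, Fin.sum_univ_three, Fin.sum_univ_three]
    simp [hpq, hqr.symm]
  have hE : ∀ p b', D ![p, p, p] b' = 0 := by
    intro p b'
    obtain ⟨q, hpq, -⟩ := hthird p p
    have h := hrow p q hpq ![p, p, q] (hC q p hpq.symm) b'
    simp [rq p q hpq, rr p q hpq, add_mul, mul_add, Finset.sum_add_distrib, 
      hA _ _ hpq, hB _ _ hpq, hC _ _ hpq, hA _ _ hpq.symm, hB _ _ hpq.symm, hC _ _ hpq.symm] at h
    refine hdiff ![p, p, p] ![q, q, q] b' p ?_ (3/5 * (3/5) * (-4/5)) (4/5 * (4/5) * (3/5)) (by norm_num) (by linear_combination h)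
    rw [Finset.card_filter, Finset.card_filter, Fin.sum_univ_three, Fin.sum_univ_three]
    simp [hpq.symm]
  ext b b'
  have hb : b = ![b 0, b 1, b 2] := by ext i; fin_cases i <;> rfl
  rw [Matrix.zero_apply, hb]
  by_cases h1 : b 0 = b 1
  · rw [h1]
    by_cases h2 : b 1 = b 2
    · rw [h2]; exact hE _ _
    · exact hC _ _ (Ne.symm h2) _
  · by_cases h2 : b 1 = b 2
    · rw [h2]; rw [h2] at h1; exact hA _ _ h1 _
    · by_cases h3 : b 0 = b 2
      · rw [h3]; exact hB _ _ h2 _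
      · exact hinj _ (inj3 _ _ _ h1 h3 h2) _

theorem schur_weyl (B : Matrix (Fin 3 → α) (Fin 3 → α) ℂ)
    (hB : ∀ U ∈ Matrix.unitaryGroup α ℂ, tensorPow 3 U * B = B * tensorPow 3 U)
    (e : Fin 3 → α) (he : Function.Injective e) (b b' : Fin 3 → α) :
    B b b' = ∑ π : Equiv.Perm (Fin 3),
      if ∀ a, b a = b' (π a) then B e (fun a => e (π.symm a)) else 0 := by
  have h := sw_zero (B - ∑ π : Equiv.Perm (Fin 3), B e (fun a => e (π.symm a)) • permOp π) ?_ e he ?_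
  · have h2 := congrFun (congrFun h b) b'
    simp only [Matrix.sub_apply, Matrix.zero_apply, Matrix.sum_apply, Matrix.smul_apply, permOp,
      smul_eq_mul, mul_ite, mul_one, mul_zero] at h2
    exact sub_eq_zero.1 h2
  · intro U hU
    rw [mul_sub, sub_mul, hB U hU, Finset.mul_sum, Finset.sum_mul]
    congr 1
    refine Finset.sum_congr rfl fun π _ => ?_
    rw [Matrix.mul_smul, Matrix.smul_mul, permOp_comm]
  · intro π
    simp only [Matrix.sub_apply, Matrix.sum_apply, Matrix.smul_apply, permOp,
      smul_eq_mul, mul_ite, mul_one, mul_zero]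
    rw [Finset.sum_eq_single π]
    · simp
    · intro σ _ hσ
      rw [if_neg]
      intro h
      apply hσ
      ext a
      have := he (h a)
      rw [Equiv.eq_symm_apply] at this
      rw [this]
    · simp
end SchurWeyl


section CAsec
variable {S : Type*} [Fintype S] [DecidableEq S]

/-- Operators (vectorized) that are combinations of permutation operators on the sites in `A`. -/
def CAs (A : Finset S) : Submodule ℂ (EuclideanSpace ℂ (S → Loc)) where
  carrier := {X | ∃ w : Fin 6 → (S → Loc) → ℂ,
    (∀ p z z', (∀ k, k ∉ A → z k = z' k) → w p z = w p z') ∧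
    ∀ z, X z = ∑ p, (∏ k ∈ A, vC p (z k)) * w p z}
  zero_mem' := ⟨fun _ _ => 0, fun _ _ _ _ => rfl, fun z => by simp⟩
  add_mem' := by
    rintro X Y ⟨w, hw, hX⟩ ⟨u, hu, hY⟩
    refine ⟨fun p z => w p z + u p z, fun p z z' h => by beta_reduce; rw [hw p z z' h, hu p z z' h], fun z => ?_⟩
    rw [PiLp.add_apply, hX, hY, ← Finset.sum_add_distrib]
    exact Finset.sum_congr rfl fun p _ => by ring
  smul_mem' := by
    rintro c X ⟨w, hw, hX⟩
    refine ⟨fun p z => c * w p z, fun p z z' h => by beta_reduce; rw [hw p z z' h], fun z => ?_⟩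
    rw [PiLp.smul_apply, hX, smul_eq_mul, Finset.mul_sum]
    exact Finset.sum_congr rfl fun p _ => by ring

theorem mem_CAs (A : Finset S) (X : EuclideanSpace ℂ (S → Loc)) :
    X ∈ CAs A ↔ ∃ w : Fin 6 → (S → Loc) → ℂ,
      (∀ p z z', (∀ k, k ∉ A → z k = z' k) → w p z = w p z') ∧
      ∀ z, X z = ∑ p, (∏ k ∈ A, vC p (z k)) * w p z := Iff.rfl

theorem CAs_anti {A B : Finset S} (h : A ⊆ B) : CAs B ≤ CAs A := by
  rintro X ⟨w, hw, hX⟩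
  refine ⟨fun p z => (∏ k ∈ B \ A, vC p (z k)) * w p z, fun p z z' hz => ?_, fun z => ?_⟩
  · beta_reduce
    rw [hw p z z' fun k hk => hz k fun hk' => hk (h hk')]
    congr 1
    exact Finset.prod_congr rfl fun k hk => by rw [hz k (Finset.mem_sdiff.1 hk).2]
  · rw [hX]
    refine Finset.sum_congr rfl fun p _ => ?_
    rw [← Finset.prod_sdiff h]
    ring

/-- Canonical local pattern. -/
def czx (P Q : S) (k : S) : Fin 3 → Fin 2 :=
  fun a => if k = P then (if a = 1 then 1 else 0) else if k = Q then (if a = 2 then 1 else 0) else 0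

def cz (P Q : S) (p : Fin 6) (k : S) : Loc := (czx P Q k, fun a => czx P Q k ((pf p).symm a))

theorem vC_cz_self (P Q : S) (p : Fin 6) (k : S) : vC p (cz P Q p k) = 1 := by
  simp [vC, cz]

theorem vC_cz_ne (P Q : S) (hPQ : P ≠ Q) (p q : Fin 6) (h : q ≠ p) :
    vC q (cz P Q p P) = 0 ∨ vC q (cz P Q p Q) = 0 := by
  by_contra! hc
  have h1 : ∀ a, czx P Q P a = czx P Q P ((pf p).symm (pf q a)) := by
    have := hc.1
    unfold vC at this
    by_contra hcon
    exact this (if_neg hcon)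
  have h2 : ∀ a, czx P Q Q a = czx P Q Q ((pf p).symm (pf q a)) := by
    have := hc.2
    unfold vC at this
    by_contra hcon
    exact this (if_neg hcon)
  apply h
  apply pf_bij.1
  ext a
  congr 1
  rw [← Equiv.symm_apply_eq (pf p)]
  have h1 := h1 a
  have h2 := h2 a
  simp only [czx, if_true, hPQ.symm, if_false] at h1 h2
  generalize (pf p).symm (pf q a) = b at *
  revert a b
  decide

def spl (P Q : S) (A : Finset S) (p : Fin 6) (z : S → Loc) : S → Loc :=
  fun k => if k ∈ A then cz P Q p k else z k

theorem prod_ne (P Q : S) (hPQ : P ≠ Q) (A B : Finset S) (hP : P ∈ A) (hQ : Q ∈ A) (hP' : P ∈ B)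
    (hQ' : Q ∈ B) (p q : Fin 6) (h : q ≠ p) (z : S → Loc) :
    ∏ k ∈ B, vC q (spl P Q A p z k) = 0 := by
  rcases vC_cz_ne P Q hPQ p q h with h0 | h0
  · exact Finset.prod_eq_zero hP' (by simpa [spl, hP] using h0)
  · exact Finset.prod_eq_zero hQ' (by simpa [spl, hQ] using h0)

theorem CAs_w (P Q : S) (hPQ : P ≠ Q) (A : Finset S) (hP : P ∈ A) (hQ : Q ∈ A)
    (X : EuclideanSpace ℂ (S → Loc)) (hX : X ∈ CAs A) (z : S → Loc) :
    X z = ∑ p, (∏ k ∈ A, vC p (z k)) * X (spl P Q A p z) := by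
  obtain ⟨w, hw, h⟩ := hX
  have : ∀ p z, X (spl P Q A p z) = w p z := by
    intro p z
    rw [h, Finset.sum_eq_single p]
    · rw [Finset.prod_eq_one, one_mul]
      · exact hw _ _ _ fun k hk => by simp [spl, hk]
      · intro k hk
        simp [spl, hk, vC_cz_self]
    · intro q _ hq
      rw [prod_ne P Q hPQ A A hP hQ hP hQ p q hq, zero_mul]
    · simp
  simp only [this]
  exact h z

theorem CAs_union (P Q : S) (hPQ : P ≠ Q) (A B : Finset S) (hP : P ∈ A) (hQ : Q ∈ A) (hP' : P ∈ B)
    (hQ' : Q ∈ B) (X : EuclideanSpace ℂ (S → Loc)) (hA : X ∈ CAs A) (hB : X ∈ CAs B) :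
    X ∈ CAs (A ∪ B) := by
  refine ⟨fun p z => X (spl P Q (A ∪ B) p z), fun p z z' hz => ?_, fun z => ?_⟩
  · refine congrArg X.ofLp ?_
    ext1 k
    by_cases hk : k ∈ A ∪ B
    · simp only [spl, hk, if_true]
    · simp only [spl, hk, if_false, hz k hk]
  · rw [CAs_w P Q hPQ A hP hQ X hA]
    refine Finset.sum_congr rfl fun p _ => ?_
    rw [CAs_w P Q hPQ B hP' hQ' X hB, Finset.sum_eq_single p]
    · rw [← mul_assoc]
      congr 1
      · rw [← Finset.union_sdiff_self_eq_union, Finset.prod_union Finset.disjoint_sdiff]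
        congr 1
        rw [← Finset.prod_sdiff (Finset.inter_subset_left : B ∩ A ⊆ B), Finset.sdiff_inter_self_left,
          Finset.prod_eq_one (s := B ∩ A), mul_one]
        · refine Finset.prod_congr rfl fun k hk => ?_
          simp [spl, (Finset.mem_sdiff.1 hk).2]
        · intro k hk
          simp [spl, (Finset.mem_inter.1 hk).2, vC_cz_self]
      · refine congrArg X.ofLp ?_
        ext1 k
        simp only [spl, Finset.mem_union]
        by_cases h1 : k ∈ A <;> by_cases h2 : k ∈ B <;> simp [h1, h2]
    · intro q _ hq
      rw [prod_ne P Q hPQ A B hP hQ hP' hQ' p q hq, zero_mul]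
    · simp

theorem sum_prod3 {A B C M : Type*} [Fintype A] [Fintype B] [Fintype C] [AddCommMonoid M]
    (g : A → B → C → M) : ∑ t : A × B × C, g t.1 t.2.1 t.2.2 = ∑ a, ∑ b, ∑ c, g a b c := by
  rw [Fintype.sum_prod_type]
  exact Finset.sum_congr rfl fun a _ => Fintype.sum_prod_type _

/-- Set three sites. -/
def set3 (i j k : S) (z : S → Loc) (s1 s2 s3 : Loc) : S → Loc :=
  fun l => if l = i then s1 else if l = j then s2 else if l = k then s3 else z l

theorem sum_nonneg_of_slices (i j k : S) (hij : i ≠ j) (hjk : j ≠ k) (hik : i ≠ k)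
    (f : (S → Loc) → ℝ) (h : ∀ z, 0 ≤ ∑ s1, ∑ s2, ∑ s3, f (set3 i j k z s1 s2 s3)) :
    0 ≤ ∑ z, f z := by
  let φ : (S → Loc) × Loc × Loc × Loc → (S → Loc) × Loc × Loc × Loc := fun t =>
    (set3 i j k t.1 t.2.1 t.2.2.1 t.2.2.2, t.1 i, t.1 j, t.1 k)
  have hφ : Function.Involutive φ := by
    rintro ⟨z, s1, s2, s3⟩
    simp only [φ, Prod.mk.injEq]
    refine ⟨?_, ?_, ?_, ?_⟩
    · ext1 l
      simp only [set3]
      split_ifs <;> simp_all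
    · simp [set3]
    · simp [set3, hij.symm]
    · simp [set3, hik.symm, hjk.symm]
  have h1 : ∑ t : (S → Loc) × Loc × Loc × Loc, f t.1 = ∑ t, f (φ t).1 :=
    (Fintype.sum_bijective φ hφ.bijective _ _ fun _ => rfl).symm
  have h2 : 0 ≤ ∑ t, f (φ t).1 := by
    rw [Fintype.sum_prod_type]
    refine Finset.sum_nonneg fun z _ => ?_
    have := h z
    rwa [← sum_prod3] at this
  rw [← h1, Fintype.sum_prod_type] at h2
  simp only [Finset.sum_const, nsmul_eq_mul] at h2
  rw [← Finset.mul_sum] at h2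
  refine nonneg_of_mul_nonneg_right h2 ?_
  have : 0 < (Finset.univ : Finset (Loc × Loc × Loc)).card := Finset.card_pos.2 Finset.univ_nonempty
  exact_mod_cast this

/-- Triple permutation vectors. -/
noncomputable def Qv (i j k : S) (p : Fin 6) (r : S → Loc) : EuclideanSpace ℂ (S → Loc) :=
  WithLp.toLp 2 fun z => if ∀ l, l ∉ ({i, j, k} : Finset S) → z l = r l then
    vC p (z i) * vC p (z j) * vC p (z k) else 0

theorem Qv_mem (i j k : S) (hij : i ≠ j) (hjk : j ≠ k) (hik : i ≠ k) (p : Fin 6) (r : S → Loc) :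
    Qv i j k p r ∈ CAs {i, j, k} := by
  refine ⟨fun q z => if q = p then (if ∀ l, l ∉ ({i, j, k} : Finset S) → z l = r l then 1 else 0)
    else 0, fun q z z' h => ?_, fun z => ?_⟩
  · have : (∀ l, l ∉ ({i, j, k} : Finset S) → z l = r l) ↔
        (∀ l, l ∉ ({i, j, k} : Finset S) → z' l = r l) :=
      ⟨fun H l hl => by rw [← h l hl, H l hl], fun H l hl => by rw [h l hl, H l hl]⟩
    simp only [this]
  · rw [Finset.sum_eq_single p]
    · rw [Finset.prod_insert (by simp [hij, hik]), Finset.prod_insert (by simp [hjk]),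
        Finset.prod_singleton]
      simp only [if_true, Qv, mul_ite, mul_one, mul_zero, mul_assoc]
    · intro q _ hq
      simp [hq]
    · simp

theorem Qv_inner (i j k : S) (hij : i ≠ j) (hjk : j ≠ k) (hik : i ≠ k) (p : Fin 6) (r : S → Loc)
    (X : EuclideanSpace ℂ (S → Loc)) : inner ℂ (Qv i j k p r) X =
      ∑ s1, ∑ s2, ∑ s3, vC p s1 * vC p s2 * vC p s3 * X (set3 i j k r s1 s2 s3) := by
  rw [PiLp.inner_apply]
  simp only [RCLike.inner_apply, Qv]
  simp_rw [apply_ite (starRingEnd ℂ), map_zero, map_mul, vC_conj, mul_ite, mul_zero]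
  rw [← Finset.sum_filter]
  rw [← sum_prod3 (fun s1 s2 s3 => vC p s1 * vC p s2 * vC p s3 * X (set3 i j k r s1 s2 s3))]
  refine Finset.sum_nbij' (fun z => (z i, z j, z k))
    (fun t => set3 i j k r t.1 t.2.1 t.2.2) ?_ ?_ ?_ ?_ ?_
  · simp
  · intro t _
    simp only [Finset.mem_filter, Finset.mem_univ, true_and]
    intro l hl
    simp only [Finset.mem_insert, Finset.mem_singleton, not_or] at hl
    simp [set3, hl]
  · intro z hz
    simp only [Finset.mem_filter, Finset.mem_univ, true_and] at hz
    ext1 l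
    simp only [set3]
    split_ifs with h1 h2 h3
    · rw [h1]
    · rw [h2]
    · rw [h3]
    · exact (hz l (by simp [h1, h2, h3])).symm
  · intro t _
    simp [set3, hij.symm, hik.symm, hjk.symm]
  · intro z hz
    simp only [Finset.mem_filter, Finset.mem_univ, true_and] at hz
    have : set3 i j k r (z i) (z j) (z k) = z := by
      ext1 l
      simp only [set3]
      split_ifs with h1 h2 h3
      · rw [h1]
      · rw [h2]
      · rw [h3]
      · exact (hz l (by simp [h1, h2, h3])).symm
    simp only [this]
    ring

theorem sum_rev3 (f : Loc → Loc → Loc → ℝ) :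
    ∑ s1, ∑ s2, ∑ s3, f s3 s2 s1 = ∑ s1, ∑ s2, ∑ s3, f s1 s2 s3 := by
  rw [Finset.sum_comm]
  simp_rw [Finset.sum_comm (f := fun s1 s3 => f s3 _ s1)]
  rw [Finset.sum_comm]

theorem sum_rev3C (f : Loc → Loc → Loc → ℂ) :
    ∑ s1, ∑ s2, ∑ s3, f s3 s2 s1 = ∑ s1, ∑ s2, ∑ s3, f s1 s2 s3 := by
  rw [Finset.sum_comm]
  simp_rw [Finset.sum_comm (f := fun s1 s3 => f s3 _ s1)]
  rw [Finset.sum_comm]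

theorem gap_ineq (i j k : S) (hij : i ≠ j) (hjk : j ≠ k) (hik : i ≠ k)
    (X Y : EuclideanSpace ℂ (S → Loc)) (hX : X ∈ CAs {i, j}) (hY : Y ∈ CAs {j, k})
    (hX0 : ∀ z ∈ CAs {i, j, k}, inner ℂ z X = 0) (hY0 : ∀ z ∈ CAs {i, j, k}, inner ℂ z Y = 0) :
    5 * (inner ℂ X Y).re ≤ ‖X‖ ^ 2 + ‖Y‖ ^ 2 := by
  obtain ⟨w, hw, hX⟩ := hX
  obtain ⟨u, hu, hY⟩ := hY
  have key := sum_nonneg_of_slices i j k hij hjk hik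
    (fun z => ‖X z‖ ^ 2 + ‖Y z‖ ^ 2 - 5 * (X z * (starRingEnd ℂ) (Y z)).re) ?_
  · rw [Finset.sum_sub_distrib, Finset.sum_add_distrib, ← EuclideanSpace.norm_sq_eq,
      ← EuclideanSpace.norm_sq_eq, ← Finset.mul_sum, ← Complex.re_sum] at key
    have e : (inner ℂ X Y).re = (∑ z, X z * (starRingEnd ℂ) (Y z)).re := by
      rw [← inner_conj_symm, Complex.conj_re, PiLp.inner_apply]
      simp [RCLike.inner_apply]
    rw [e]; linarith
  · intro z
    let s0 : Loc := (fun _ => 0, fun _ => 0)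
    let w' : Fin 6 → Loc → ℂ := fun p s => w p (set3 i j k z s0 s0 s)
    let u' : Fin 6 → Loc → ℂ := fun p s => u p (set3 i j k z s s0 s0)
    have ex : ∀ s1 s2 s3, X (set3 i j k z s1 s2 s3) = xw w' s1 s2 s3 := by
      intro s1 s2 s3
      rw [hX, xw]
      refine Finset.sum_congr rfl fun p _ => ?_
      rw [Finset.prod_insert (by simp [hij]), Finset.prod_singleton]
      congr 1
      · simp [set3, hij.symm]
      · apply hw
        intro l hl
        simp only [Finset.mem_insert, Finset.mem_singleton, not_or] at hl
        simp [set3, hl]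
    have ey : ∀ s1 s2 s3, Y (set3 i j k z s1 s2 s3) = xw u' s3 s2 s1 := by
      intro s1 s2 s3
      rw [hY, xw]
      refine Finset.sum_congr rfl fun p _ => ?_
      rw [Finset.prod_insert (by simp [hjk]), Finset.prod_singleton]
      congr 1
      · simp [set3, hij.symm, hik.symm, hjk.symm, mul_comm]
      · apply hu
        intro l hl
        simp only [Finset.mem_insert, Finset.mem_singleton, not_or] at hl
        simp [set3, hl]
    have h := slice_two w' u' ?_ ?_
    · simp only [ex, ey]
      simp only [Finset.sum_sub_distrib, Finset.sum_add_distrib, ← Finset.mul_sum, ← Complex.re_sum]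
      rw [sum_rev3 (fun s1 s2 s3 => ‖xw u' s1 s2 s3‖ ^ 2)]
      linarith
    · intro p
      have := hX0 _ (Qv_mem i j k hij hjk hik p z)
      rw [Qv_inner i j k hij hjk hik] at this
      simpa only [ex] using this
    · intro p
      have := hY0 _ (Qv_mem i j k hij hjk hik p z)
      rw [Qv_inner i j k hij hjk hik] at this
      simp only [ey] at this
      rw [← this, ← sum_rev3C]
      refine Finset.sum_congr rfl fun s1 _ => Finset.sum_congr rfl fun s2 _ =>
        Finset.sum_congr rfl fun s3 _ => by ring

theorem CAs_triple (i j k : S) (hij : i ≠ j) (hjk : j ≠ k) (hik : i ≠ k) :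
    CAs {i, j} ⊓ CAs {j, k} ≤ CAs {i, j, k} := by
  intro X hX
  have s1 : CAs {i, j, k} ≤ CAs {i, j} := CAs_anti (by intro l; simp; tauto)
  have s2 : CAs {i, j, k} ≤ CAs {j, k} := CAs_anti (by intro l; simp; tauto)
  set q := (CAs {i, j, k}).starProjection X with hq
  have hqm : q ∈ CAs {i, j, k} := Submodule.starProjection_apply_mem _ _
  have ho : X - q ∈ (CAs {i, j, k})ᗮ := Submodule.sub_starProjection_mem_orthogonal _
  have ho' := (Submodule.mem_orthogonal _ _).1 ho
  have := gap_ineq i j k hij hjk hik (X - q) (X - q) (Submodule.sub_mem _ hX.1 (s1 hqm))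
    (Submodule.sub_mem _ hX.2 (s2 hqm)) ho' ho'
  have e : (inner ℂ (X - q) (X - q)).re = ‖X - q‖ ^ 2 := by
    rw [inner_self_eq_norm_sq_to_K]; norm_cast
  rw [e] at this
  have h0 : ‖X - q‖ ^ 2 = 0 := le_antisymm (by linarith) (sq_nonneg _)
  rw [sq_eq_zero_iff, norm_eq_zero, sub_eq_zero] at h0
  rw [h0]; exact hqm
end CAsec


section HaarAvg
variable {E : Type*} [NormedAddCommGroup E] [InnerProductSpace ℂ E] [FiniteDimensional ℂ E]
variable {G : Type*} [Group G] [TopologicalSpace G] [MeasurableSpace G] [BorelSpace G]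

/-- Fixed subspace of a family of linear maps. -/
def fixSub {ι : Type*} (R : ι → E →ₗ[ℂ] E) : Submodule ℂ E where
  carrier := {x | ∀ g, R g x = x}
  zero_mem' := fun g => map_zero _
  add_mem' := fun hx hy g => by rw [map_add, hx g, hy g]
  smul_mem' := fun c x hx g => by rw [map_smul, hx g]

theorem mem_fixSub {ι : Type*} (R : ι → E →ₗ[ℂ] E) (x : E) : x ∈ fixSub R ↔ ∀ g, R g x = x := Iff.rfl

theorem rep_integrable (μ : Measure G) [IsProbabilityMeasure μ]
    (R : G → E →ₗ[ℂ] E) (hi : ∀ g x y, inner ℂ (R g x) (R g y) = inner ℂ x y)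
    (hc : ∀ x, Continuous fun g => R g x) (x : E) : Integrable (fun g => R g x) μ := by
  haveI : CompleteSpace E := FiniteDimensional.complete ℂ E
  haveI : ProperSpace E := FiniteDimensional.proper ℂ E
  refine Integrable.of_bound (C := ‖x‖) (hc x).aestronglyMeasurable (Filter.Eventually.of_forall fun g => ?_)
  have := hi g x x
  rw [inner_self_eq_norm_sq_to_K, inner_self_eq_norm_sq_to_K] at this
  have h : ‖R g x‖ ^ 2 = ‖x‖ ^ 2 := by exact_mod_cast this
  exact le_of_eq ((sq_eq_sq₀ (norm_nonneg _) (norm_nonneg _)).1 h)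

theorem map_avg (μ : Measure G) [IsProbabilityMeasure μ]
    (R : G → E →ₗ[ℂ] E) (hi : ∀ g x y, inner ℂ (R g x) (R g y) = inner ℂ x y)
    (hc : ∀ x, Continuous fun g => R g x) (x : E) (L : E →ₗ[ℂ] E) :
    L (∫ g, R g x ∂μ) = ∫ g, L (R g x) ∂μ := by
  haveI : CompleteSpace E := FiniteDimensional.complete ℂ E
  exact ((LinearMap.toContinuousLinearMap L).integral_comp_comm (rep_integrable μ R hi hc x)).symm

theorem haar_proj [ContinuousMul G] (μ : Measure G) [μ.IsMulLeftInvariant] [IsProbabilityMeasure μ]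
    (R : G → E →ₗ[ℂ] E) (hi : ∀ g x y, inner ℂ (R g x) (R g y) = inner ℂ x y)
    (hm : ∀ g h x, R (g * h) x = R g (R h x))
    (hc : ∀ x, Continuous fun g => R g x) (x : E) :
    (fixSub R).starProjection x = ∫ g, R g x ∂μ := by
  haveI : CompleteSpace E := FiniteDimensional.complete ℂ E
  apply Submodule.eq_starProjection_of_mem_of_inner_eq_zero
  · intro h
    rw [map_avg μ R hi hc x (R h)]
    simp_rw [← hm]
    exact integral_mul_left_eq_self (fun g => R g x) h
  · intro y hy
    rw [← inner_conj_symm, inner_sub_right, ← integral_inner (rep_integrable μ R hi hc x)]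
    have : ∀ g, inner ℂ y (R g x) = inner ℂ y x := fun g => by
      conv_lhs => rw [← hy g]
      exact hi g y x
    simp [this]

theorem comm_avg (μ : Measure G) [IsProbabilityMeasure μ]
    (R : G → E →ₗ[ℂ] E) (hi : ∀ g x y, inner ℂ (R g x) (R g y) = inner ℂ x y)
    (hc : ∀ x, Continuous fun g => R g x) (x : E) (L : E →ₗ[ℂ] E)
    (hL : ∀ g, L (R g x) = R g (L x)) (hx : L x = x) : L (∫ g, R g x ∂μ) = ∫ g, R g x ∂μ := by
  rw [map_avg μ R hi hc]
  simp_rw [hL, hx]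
end HaarAvg



section Gate
variable {n : ℕ} [NeZero n]

/-- Replace the qubits at `i`, `i+1`. -/
def upd1 (i : ZMod n) (x : ZMod n → Fin 2) (b : Fin 2 × Fin 2) : ZMod n → Fin 2 :=
  fun k => if k = i then b.1 else if k = i + 1 then b.2 else x k

theorem upd1_i (i : ZMod n) (x : ZMod n → Fin 2) (b : Fin 2 × Fin 2) : upd1 i x b i = b.1 := by
  simp [upd1]

theorem upd1_i1 (i : ZMod n) (hi : i + 1 ≠ i) (x : ZMod n → Fin 2) (b : Fin 2 × Fin 2) :
    upd1 i x b (i + 1) = b.2 := by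
  simp only [upd1, hi, if_true, if_false]

theorem upd1_self (i : ZMod n) (x : ZMod n → Fin 2) : upd1 i x (x i, x (i + 1)) = x := by
  ext1 k
  simp only [upd1]
  split_ifs with h h'
  · rw [h]
  · rw [h']
  · rfl

theorem ringGate_eq (i : ZMod n) (hi : i + 1 ≠ i) (U : Matrix (Fin 2 × Fin 2) (Fin 2 × Fin 2) ℂ)
    (x z : ZMod n → Fin 2) : ringGate n i U x z =
      ∑ b, if z = upd1 i x b then U (x i, x (i + 1)) b else 0 := by
  have h : ∀ b, z = upd1 i x b ↔ b = (z i, z (i + 1)) ∧ ∀ k, k ≠ i ∧ k ≠ i + 1 → x k = z k := by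
    intro b
    constructor
    · intro h
      refine ⟨?_, ?_⟩
      · rw [h, upd1_i, upd1_i1 i hi]
      · rintro k ⟨h1, h2⟩
        rw [h]; simp only [upd1, h1, h2, if_false]
    · rintro ⟨h1, h2⟩
      ext1 k
      simp only [upd1, h1]
      split_ifs with h h'
      · rw [h]
      · rw [h']
      · exact (h2 k ⟨h, h'⟩).symm
  simp only [h, ringGate, Finset.prod_ite_zero, Finset.mem_filter, Finset.mem_univ, true_and,
    Finset.prod_const_one]
  by_cases hc : ∀ k, k ≠ i ∧ k ≠ i + 1 → x k = z k
  · rw [if_pos hc]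
    simp only [eq_true hc, and_true, mul_one, Finset.sum_ite_eq', Finset.mem_univ, if_true]
  · simp only [hc, and_false, if_false, mul_zero, Finset.sum_const_zero]

theorem ringGate_transpose (i : ZMod n) (U : Matrix (Fin 2 × Fin 2) (Fin 2 × Fin 2) ℂ) :
    ringGate n i Uᵀ = (ringGate n i U)ᵀ := by
  ext x z
  simp only [ringGate, Matrix.transpose_apply]
  congr 1
  exact Finset.prod_congr rfl fun k _ => by simp only [eq_comm]

theorem ringGate_conjTranspose (i : ZMod n) (U : Matrix (Fin 2 × Fin 2) (Fin 2 × Fin 2) ℂ) :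
    ringGate n i Uᴴ = (ringGate n i U)ᴴ := by
  ext x z
  simp only [ringGate, Matrix.conjTranspose_apply]
  rw [star_mul', star_prod]
  congr 1
  exact Finset.prod_congr rfl fun k _ => by
    by_cases h : x k = z k <;> simp [h, eq_comm]

theorem ringGate_mul_apply (i : ZMod n) (hi : i + 1 ≠ i)
    (U : Matrix (Fin 2 × Fin 2) (Fin 2 × Fin 2) ℂ)
    (M : Matrix (ZMod n → Fin 2) (ZMod n → Fin 2) ℂ) (x y : ZMod n → Fin 2) :
    (ringGate n i U * M) x y = ∑ b, U (x i, x (i + 1)) b * M (upd1 i x b) y := by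
  rw [Matrix.mul_apply]
  simp only [ringGate_eq i hi, Finset.sum_mul]
  rw [Finset.sum_comm]
  simp

theorem ringGate_mul (i : ZMod n) (hi : i + 1 ≠ i) (U V : Matrix (Fin 2 × Fin 2) (Fin 2 × Fin 2) ℂ) :
    ringGate n i (U * V) = ringGate n i U * ringGate n i V := by
  ext x y
  rw [ringGate_mul_apply i hi]
  simp only [ringGate, upd1_i, upd1_i1 i hi, Matrix.mul_apply, Finset.sum_mul]
  refine Finset.sum_congr rfl fun b _ => ?_
  rw [← mul_assoc]
  congr 1
  refine Finset.prod_congr rfl fun k hk => ?_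
  simp only [Finset.mem_filter, Finset.mem_univ, true_and] at hk
  simp only [upd1, hk.1, hk.2, if_false]

theorem ringGate_one (i : ZMod n) (hi : i + 1 ≠ i) : ringGate n i 1 = 1 := by
  ext x y
  rw [ringGate_eq i hi]
  simp only [Matrix.one_apply]
  rw [Finset.sum_eq_single (x i, x (i + 1))]
  · simp only [if_true, upd1_self]
    simp only [eq_comm]
  · intro b _ hb
    simp [hb.symm]
  · simp

theorem ringGate_comm (i j : ZMod n) (hi : i + 1 ≠ i) (hj : j + 1 ≠ j) (h1 : j ≠ i) (h2 : j ≠ i + 1)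
    (h3 : i ≠ j + 1) (U V : Matrix (Fin 2 × Fin 2) (Fin 2 × Fin 2) ℂ) :
    ringGate n i U * ringGate n j V = ringGate n j V * ringGate n i U := by
  suffices H : ringGate n i U * (ringGate n j V * 1) = ringGate n j V * (ringGate n i U * 1) by
    simpa only [mul_one] using H
  have h4 : j + 1 ≠ i + 1 := fun h => h1 (add_right_cancel h)
  ext x y
  rw [ringGate_mul_apply i hi, ringGate_mul_apply j hj]
  simp only [ringGate_mul_apply i hi, ringGate_mul_apply j hj, Finset.mul_sum]
  rw [Finset.sum_comm]
  refine Finset.sum_congr rfl fun c _ => Finset.sum_congr rfl fun b _ => ?_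
  have e1 : upd1 j (upd1 i x b) c = upd1 i (upd1 j x c) b := by
    ext1 k
    simp only [upd1]
    split_ifs <;> simp_all
  have e2 : upd1 i x b j = x j := by simp [upd1, h1, h2]
  have e3 : upd1 i x b (j + 1) = x (j + 1) := by simp only [upd1, h3.symm, h4, if_false]
  have e4 : upd1 j x c i = x i := by simp [upd1, h1.symm, h3]
  have e5 : upd1 j x c (i + 1) = x (i + 1) := by simp only [upd1, h2.symm, h4.symm, if_false]
  rw [e1, e2, e3, e4, e5]
  ring

theorem ringGate_unitary (i : ZMod n) (hi : i + 1 ≠ i) {U : Matrix (Fin 2 × Fin 2) (Fin 2 × Fin 2) ℂ}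
    (hU : U ∈ Matrix.unitaryGroup (Fin 2 × Fin 2) ℂ) :
    ringGate n i U ∈ Matrix.unitaryGroup (ZMod n → Fin 2) ℂ := by
  rw [Matrix.mem_unitaryGroup_iff, Matrix.star_eq_conjTranspose] at hU ⊢
  rw [← ringGate_conjTranspose, ← ringGate_mul i hi, hU, ringGate_one i hi]

/-- Replace the qubits at `i`, `i+1` in all three copies. -/
def upd3 (i : ZMod n) (x : Fin 3 → ZMod n → Fin 2) (c : Fin 3 → Fin 2 × Fin 2) :
    Fin 3 → ZMod n → Fin 2 := fun a => upd1 i (x a) (c a)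

/-- Restriction to the two sites. -/
def rs3 (i : ZMod n) (x : Fin 3 → ZMod n → Fin 2) : Fin 3 → Fin 2 × Fin 2 :=
  fun a => (x a i, x a (i + 1))

theorem upd3_rs3 (i : ZMod n) (x : Fin 3 → ZMod n → Fin 2) : upd3 i x (rs3 i x) = x := by
  ext1 a
  exact upd1_self i (x a)

theorem rs3_upd3 (i : ZMod n) (hi : i + 1 ≠ i) (x : Fin 3 → ZMod n → Fin 2)
    (c : Fin 3 → Fin 2 × Fin 2) : rs3 i (upd3 i x c) = c := by
  ext1 a
  simp only [rs3, upd3, upd1_i, upd1_i1 i hi]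

theorem upd3_upd3 (i : ZMod n) (x : Fin 3 → ZMod n → Fin 2)
    (c d : Fin 3 → Fin 2 × Fin 2) : upd3 i (upd3 i x c) d = upd3 i x d := by
  ext a k
  simp only [upd3, upd1]
  split_ifs <;> rfl

theorem tp_eq (i : ZMod n) (hi : i + 1 ≠ i) (U : Matrix (Fin 2 × Fin 2) (Fin 2 × Fin 2) ℂ)
    (x z : Fin 3 → ZMod n → Fin 2) : tensorPow 3 (ringGate n i U) x z =
      ∑ c, if z = upd3 i x c then tensorPow 3 U (rs3 i x) c else 0 := by
  simp only [tensorPow, ringGate_eq i hi]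
  rw [Finset.prod_univ_sum, Fintype.piFinset_univ]
  refine Finset.sum_congr rfl fun c _ => ?_
  rw [Finset.prod_ite_zero]
  simp [funext_iff (f := z), upd3, rs3]

theorem tp_left (i : ZMod n) (hi : i + 1 ≠ i) (U : Matrix (Fin 2 × Fin 2) (Fin 2 × Fin 2) ℂ)
    (M : Matrix (Fin 3 → ZMod n → Fin 2) (Fin 3 → ZMod n → Fin 2) ℂ)
    (x y : Fin 3 → ZMod n → Fin 2) : (tensorPow 3 (ringGate n i U) * M) x y =
      ∑ c, tensorPow 3 U (rs3 i x) c * M (upd3 i x c) y := by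
  rw [Matrix.mul_apply]
  simp only [tp_eq i hi, Finset.sum_mul]
  rw [Finset.sum_comm]
  simp

theorem tensorPow_transpose {α : Type*} [Fintype α] (A : Matrix α α ℂ) :
    tensorPow 3 Aᵀ = (tensorPow 3 A)ᵀ := rfl

theorem tp_right (i : ZMod n) (hi : i + 1 ≠ i) (U : Matrix (Fin 2 × Fin 2) (Fin 2 × Fin 2) ℂ)
    (M : Matrix (Fin 3 → ZMod n → Fin 2) (Fin 3 → ZMod n → Fin 2) ℂ)
    (x y : Fin 3 → ZMod n → Fin 2) : (M * tensorPow 3 (ringGate n i U)) x y =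
      ∑ c, M x (upd3 i y c) * tensorPow 3 U c (rs3 i y) := by
  have := tp_left i hi Uᵀ Mᵀ y x
  rw [ringGate_transpose, tensorPow_transpose, tensorPow_transpose, ← Matrix.transpose_mul,
    Matrix.transpose_apply] at this
  rw [this]
  refine Finset.sum_congr rfl fun c _ => ?_
  rw [Matrix.transpose_apply, Matrix.transpose_apply, mul_comm]

/-- A block of an operator on the sites `i`, `i+1`. -/
def blk (i : ZMod n) (M : Matrix (Fin 3 → ZMod n → Fin 2) (Fin 3 → ZMod n → Fin 2) ℂ)
    (x y : Fin 3 → ZMod n → Fin 2) : Matrix (Fin 3 → Fin 2 × Fin 2) (Fin 3 → Fin 2 × Fin 2) ℂ :=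
  Matrix.of fun b b' => M (upd3 i x b) (upd3 i y b')

theorem blk_comm (i : ZMod n) (hi : i + 1 ≠ i) (U : Matrix (Fin 2 × Fin 2) (Fin 2 × Fin 2) ℂ)
    (M : Matrix (Fin 3 → ZMod n → Fin 2) (Fin 3 → ZMod n → Fin 2) ℂ) :
    tensorPow 3 (ringGate n i U) * M = M * tensorPow 3 (ringGate n i U) ↔
      ∀ x y, tensorPow 3 U * blk i M x y = blk i M x y * tensorPow 3 U := by
  constructor
  · intro h x y
    ext b b'
    have := congrFun (congrFun h (upd3 i x b)) (upd3 i y b')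
    rw [tp_left i hi, tp_right i hi] at this
    simp only [upd3_upd3, rs3_upd3 i hi] at this
    rw [Matrix.mul_apply, Matrix.mul_apply]
    exact this
  · intro h
    ext x y
    have := congrFun (congrFun (h x y) (rs3 i x)) (rs3 i y)
    rw [tp_left i hi, tp_right i hi]
    rw [Matrix.mul_apply, Matrix.mul_apply] at this
    simpa only [blk, Matrix.of_apply, upd3_rs3] using this
end Gate


section Final
variable {S : Type*} [Fintype S] [DecidableEq S]

/-- Regrouping of indices site by site. -/
def idxE : (S → Loc) ≃ (Fin 3 → S → Fin 2) × (Fin 3 → S → Fin 2) where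
  toFun z := (fun a k => (z k).1 a, fun a k => (z k).2 a)
  invFun t := fun k => (fun a => t.1 a k, fun a => t.2 a k)
  left_inv _ := rfl
  right_inv _ := rfl

/-- Vectorization. -/
noncomputable def toE : Matrix (Fin 3 → S → Fin 2) (Fin 3 → S → Fin 2) ℂ ≃ₗ[ℂ]
    EuclideanSpace ℂ (S → Loc) where
  toFun X := WithLp.toLp 2 fun z => X (idxE z).1 (idxE z).2
  invFun v := Matrix.of fun x y => v (idxE.symm (x, y))
  map_add' _ _ := rfl
  map_smul' _ _ := rfl
  left_inv _ := rfl
  right_inv _ := rfl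

theorem toE_apply (X : Matrix (Fin 3 → S → Fin 2) (Fin 3 → S → Fin 2) ℂ) (z : S → Loc) :
    toE X z = X (idxE z).1 (idxE z).2 := rfl

theorem toE_symm_apply (v : EuclideanSpace ℂ (S → Loc)) (x y : Fin 3 → S → Fin 2) :
    toE.symm v x y = v (idxE.symm (x, y)) := rfl

theorem toE_norm (X : Matrix (Fin 3 → S → Fin 2) (Fin 3 → S → Fin 2) ℂ) :
    ‖toE X‖ = frobNorm X := by
  rw [EuclideanSpace.norm_eq, frobNorm, ← Fintype.sum_prod_type', ← Equiv.sum_comp idxE]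
  rfl

theorem toE_inner (X Y : Matrix (Fin 3 → S → Fin 2) (Fin 3 → S → Fin 2) ℂ) :
    inner ℂ (toE X) (toE Y) = (Xᴴ * Y).trace := by
  rw [PiLp.inner_apply, Matrix.trace]
  simp only [Matrix.diag_apply, Matrix.mul_apply, Matrix.conjTranspose_apply]
  rw [Finset.sum_comm, ← Fintype.sum_prod_type', ← Equiv.sum_comp idxE]
  refine Finset.sum_congr rfl fun z _ => ?_
  rw [RCLike.inner_apply, mul_comm]
  rfl

/-- Conjugation superoperator. -/
noncomputable def adK (K : Matrix (Fin 3 → S → Fin 2) (Fin 3 → S → Fin 2) ℂ) :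
    EuclideanSpace ℂ (S → Loc) →ₗ[ℂ] EuclideanSpace ℂ (S → Loc) where
  toFun v := toE (K * toE.symm v * Kᴴ)
  map_add' v w := by rw [map_add, mul_add, add_mul, map_add]
  map_smul' c v := by
    rw [map_smul, Matrix.mul_smul, Matrix.smul_mul, map_smul]; rfl

theorem adK_apply (K : Matrix (Fin 3 → S → Fin 2) (Fin 3 → S → Fin 2) ℂ)
    (v : EuclideanSpace ℂ (S → Loc)) : adK K v = toE (K * toE.symm v * Kᴴ) := rfl

theorem adK_mul (K L : Matrix (Fin 3 → S → Fin 2) (Fin 3 → S → Fin 2) ℂ)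
    (v : EuclideanSpace ℂ (S → Loc)) : adK (K * L) v = adK K (adK L v) := by
  simp only [adK_apply, LinearEquiv.symm_apply_apply, Matrix.conjTranspose_mul, Matrix.mul_assoc]

theorem adK_inner (K : Matrix (Fin 3 → S → Fin 2) (Fin 3 → S → Fin 2) ℂ)
    (hK : K ∈ Matrix.unitaryGroup _ ℂ) (v w : EuclideanSpace ℂ (S → Loc)) :
    inner ℂ (adK K v) (adK K w) = inner ℂ v w := by
  have h : Kᴴ * K = 1 := Matrix.mem_unitaryGroup_iff'.1 hK
  rw [adK_apply, adK_apply, toE_inner]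
  conv_rhs => rw [← LinearEquiv.apply_symm_apply toE v, ← LinearEquiv.apply_symm_apply toE w, toE_inner]
  generalize toE.symm v = X
  generalize toE.symm w = Y
  simp only [Matrix.conjTranspose_mul, Matrix.conjTranspose_conjTranspose]
  have : K * (Xᴴ * Kᴴ) * (K * Y * Kᴴ) = K * (Xᴴ * Y * Kᴴ) := by
    calc _ = K * (Xᴴ * (Kᴴ * K) * Y * Kᴴ) := by simp only [Matrix.mul_assoc]
      _ = _ := by rw [h, mul_one]
  rw [this, Matrix.trace_mul_comm, Matrix.mul_assoc, h, mul_one]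

theorem adK_fix (K : Matrix (Fin 3 → S → Fin 2) (Fin 3 → S → Fin 2) ℂ)
    (hK : K ∈ Matrix.unitaryGroup _ ℂ) (v : EuclideanSpace ℂ (S → Loc)) :
    adK K v = v ↔ K * toE.symm v = toE.symm v * K := by
  have h : Kᴴ * K = 1 := Matrix.mem_unitaryGroup_iff'.1 hK
  have h' : K * Kᴴ = 1 := Matrix.mem_unitaryGroup_iff.1 hK
  rw [adK_apply, ← LinearEquiv.eq_symm_apply]
  constructor
  · intro e
    conv_rhs => rw [← e]
    rw [Matrix.mul_assoc, h, mul_one]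
  · intro e
    rw [e, Matrix.mul_assoc, h', mul_one]

theorem adK_cont {G : Type*} [TopologicalSpace G]
    (K : G → Matrix (Fin 3 → S → Fin 2) (Fin 3 → S → Fin 2) ℂ) (hK : Continuous K)
    (v : EuclideanSpace ℂ (S → Loc)) : Continuous fun g => adK (K g) v := by
  have h1 : Continuous fun g => K g * toE.symm v * (K g)ᴴ :=
    (hK.matrix_mul continuous_const).matrix_mul hK.matrix_conjTranspose
  exact (LinearMap.continuous_of_finiteDimensional
    (toE (S := S)).toLinearMap).comp h1

theorem tensorPow_cont {α G : Type*} [Fintype α] [TopologicalSpace G] (A : G → Matrix α α ℂ)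
    (hA : Continuous A) : Continuous fun g => tensorPow 3 (A g) := by
  refine continuous_matrix fun x y => ?_
  unfold tensorPow
  exact continuous_finset_prod _ fun a _ => hA.matrix_elem _ _

theorem ringGate_cont {n : ℕ} [NeZero n] (i : ZMod n) {G : Type*} [TopologicalSpace G]
    (A : G → Matrix (Fin 2 × Fin 2) (Fin 2 × Fin 2) ℂ)
    (hA : Continuous A) : Continuous fun g => ringGate n i (A g) := by
  refine continuous_matrix fun x y => ?_
  unfold ringGate
  exact (hA.matrix_elem _ _).mul continuous_const

/-- The Haar superoperator representation. -/
noncomputable def repH (V : Matrix.unitaryGroup (S → Fin 2) ℂ) :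
    EuclideanSpace ℂ (S → Loc) →ₗ[ℂ] EuclideanSpace ℂ (S → Loc) :=
  adK (tensorPow 3 (V : Matrix (S → Fin 2) (S → Fin 2) ℂ))

/-- The local superoperator representation. -/
noncomputable def repL {n : ℕ} [NeZero n] (i : ZMod n)
    (U : Matrix.unitaryGroup (Fin 2 × Fin 2) ℂ) :
    EuclideanSpace ℂ (ZMod n → Loc) →ₗ[ℂ] EuclideanSpace ℂ (ZMod n → Loc) :=
  adK (tensorPow 3 (ringGate n i (U : Matrix (Fin 2 × Fin 2) (Fin 2 × Fin 2) ℂ)))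

theorem univ_le_fixH : CAs (Finset.univ : Finset S) ≤ fixSub (repH (S := S)) := by
  rintro X ⟨w, hw, hX⟩ V
  rw [repH, adK_fix _ (tensorPow_unitary 3 V.2)]
  have : toE.symm X = ∑ p, w p (fun _ => (fun _ => 0, fun _ => 0)) • permOp (pf p) := by
    ext x y
    rw [toE_symm_apply, hX, Matrix.sum_apply]
    refine Finset.sum_congr rfl fun p _ => ?_
    rw [Matrix.smul_apply, smul_eq_mul, mul_comm]
    congr 1
    · exact hw _ _ _ fun k hk => absurd (Finset.mem_univ k) hk
    · simp only [vC, permOp, Finset.prod_ite_zero, Finset.mem_univ, forall_true_left,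
        Finset.prod_const_one]
      congr 1
      simp only [idxE, Equiv.coe_fn_symm_mk, funext_iff, eq_iff_iff]
      exact ⟨fun h a k => h k a, fun h k a => h a k⟩
  rw [this, Finset.mul_sum, Finset.sum_mul]
  refine Finset.sum_congr rfl fun p _ => ?_
  rw [Matrix.mul_smul, Matrix.smul_mul, permOp_comm]

theorem fixL_eq {n : ℕ} [NeZero n] (i : ZMod n) (hi : i + 1 ≠ i) :
    fixSub (repL i) = CAs {i, i + 1} := by
  ext X
  have h1 : X ∈ fixSub (repL i) ↔ ∀ U ∈ Matrix.unitaryGroup (Fin 2 × Fin 2) ℂ, ∀ x y,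
      tensorPow 3 U * blk i (toE.symm X) x y = blk i (toE.symm X) x y * tensorPow 3 U := by
    rw [mem_fixSub]
    constructor
    · intro h U hU
      have := h ⟨U, hU⟩
      rw [repL, adK_fix _ (tensorPow_unitary 3 (ringGate_unitary i hi hU))] at this
      exact (blk_comm i hi U _).1 this
    · intro h U
      rw [repL, adK_fix _ (tensorPow_unitary 3 (ringGate_unitary i hi U.2))]
      exact (blk_comm i hi U _).2 (h U U.2)
  rw [h1]
  constructor
  · intro h
    let e : Fin 3 → Fin 2 × Fin 2 := ![(0, 0), (0, 1), (1, 0)]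
    have he : Function.Injective e := by decide
    refine ⟨fun p z => toE.symm X (upd3 i (idxE z).1 e)
      (upd3 i (idxE z).2 (fun a => e ((pf p).symm a))), fun p z z' hz => ?_, fun z => ?_⟩
    · refine congrArg₂ (toE.symm X) ?_ ?_
      · ext a k
        simp only [upd3, upd1]
        split_ifs with h1 h2
        · rfl
        · rfl
        · have := hz k (by simp [h1, h2])
          simp only [idxE, Equiv.coe_fn_mk, this]
      · ext a k
        simp only [upd3, upd1]
        split_ifs with h1 h2
        · rfl
        · rfl
        · have := hz k (by simp [h1, h2])
          simp only [idxE, Equiv.coe_fn_mk, this]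
    · have := schur_weyl (blk i (toE.symm X) (idxE z).1 (idxE z).2)
        (fun U hU => h U hU _ _) e he (rs3 i (idxE z).1) (rs3 i (idxE z).2)
      simp only [blk, Matrix.of_apply, upd3_rs3] at this
      rw [toE_symm_apply, Prod.mk.eta, Equiv.symm_apply_apply] at this
      rw [this]
      rw [← (Equiv.ofBijective pf pf_bij).sum_comp]
      refine Finset.sum_congr rfl fun p _ => ?_
      rw [Finset.prod_insert (by simpa using hi.symm), Finset.prod_singleton]
      simp only [Equiv.ofBijective_apply, vC]
      have hc : (∀ a, rs3 i (idxE z).1 a = rs3 i (idxE z).2 (pf p a)) ↔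
          (∀ a, (z i).1 a = (z i).2 (pf p a)) ∧ (∀ a, (z (i + 1)).1 a = (z (i + 1)).2 (pf p a)) := by
        simp only [rs3, idxE, Equiv.coe_fn_mk, Prod.mk.injEq]
        exact forall_and
      simp only [hc]
      by_cases c1 : (∀ a, (z i).1 a = (z i).2 (pf p a)) <;>
        by_cases c2 : (∀ a, (z (i + 1)).1 a = (z (i + 1)).2 (pf p a)) <;> simp [c1, c2]
  · rintro ⟨w, hw, hX⟩ U hU x y
    have : blk i (toE.symm X) x y = ∑ p, w p (idxE.symm (x, y)) • permOp (pf p) := by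
      ext b b'
      rw [blk, Matrix.of_apply, toE_symm_apply, hX, Matrix.sum_apply]
      refine Finset.sum_congr rfl fun p _ => ?_
      rw [Matrix.smul_apply, smul_eq_mul, mul_comm]
      congr 1
      · apply hw
        intro k hk
        simp only [Finset.mem_insert, Finset.mem_singleton, not_or] at hk
        simp only [idxE, Equiv.coe_fn_symm_mk, upd3, upd1, hk.1, hk.2, if_false]
      · rw [Finset.prod_insert (by simpa using hi.symm), Finset.prod_singleton]
        simp only [vC, permOp, idxE, Equiv.coe_fn_symm_mk, upd3, upd1_i, upd1_i1 i hi]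
        have hc : (∀ a, b a = b' (pf p a)) ↔
            (∀ a, (b a).1 = (b' (pf p a)).1) ∧ (∀ a, (b a).2 = (b' (pf p a)).2) := by
          simp only [Prod.ext_iff]
          exact forall_and
        simp only [hc]
        by_cases c1 : (∀ a, (b a).1 = (b' (pf p a)).1) <;>
          by_cases c2 : (∀ a, (b a).2 = (b' (pf p a)).2) <;> simp [c1, c2]
    rw [this, Finset.mul_sum, Finset.sum_mul]
    refine Finset.sum_congr rfl fun p _ => ?_
    rw [Matrix.mul_smul, Matrix.smul_mul, permOp_comm]
end Final


section Final2
variable {n : ℕ} [NeZero n]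

theorem one_ne (hn : 3 ≤ n) (i : ZMod n) : i + 1 ≠ i := by
  haveI : Fact (1 < n) := ⟨by omega⟩
  simp

theorem two_ne (hn : 3 ≤ n) (i : ZMod n) : i ≠ i + 1 + 1 := by
  intro h
  have h2 : ((2 : ℕ) : ZMod n) = 0 := by
    push_cast
    linear_combination -h
  rw [ZMod.natCast_eq_zero_iff] at h2
  exact absurd (Nat.le_of_dvd (by norm_num) h2) (by omega)

theorem CAs_range (hn : 3 ≤ n) (X : EuclideanSpace ℂ (ZMod n → Loc))
    (hX : ∀ i : ZMod n, X ∈ CAs {i, i + 1}) (m : ℕ) :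
    X ∈ CAs ((Finset.range (m + 2)).image (Nat.cast : ℕ → ZMod n)) := by
  induction m with
  | zero =>
    have : (Finset.range (0 + 2)).image (Nat.cast : ℕ → ZMod n) = {0, 0 + 1} := by
      ext k
      simp [Finset.range_add_one, or_comm]
    rw [this]
    exact hX 0
  | succ m ih =>
    have h3 := CAs_triple ((m : ℕ) : ZMod n) (m + 1) (m + 1 + 1) (one_ne hn _).symm (one_ne hn _).symm
      (two_ne hn _) ⟨hX _, hX _⟩
    have hu := CAs_union ((m : ℕ) : ZMod n) (m + 1) (one_ne hn _).symm _ _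
      (Finset.mem_image.2 ⟨m, by simp, rfl⟩) (Finset.mem_image.2 ⟨m + 1, by simp, by simp⟩)
      (by simp) (by simp) X ih h3
    refine CAs_anti ?_ hu
    intro k hk
    rw [Finset.mem_image] at hk
    obtain ⟨j, hj, rfl⟩ := hk
    rw [Finset.mem_range] at hj
    rw [Finset.mem_union]
    by_cases hj' : j < m + 2
    · exact Or.inl (Finset.mem_image.2 ⟨j, by simpa using hj', rfl⟩)
    · have : j = m + 2 := by omega
      right
      subst this
      simp [add_assoc]
      norm_num

theorem fixH_eq (hn : 3 ≤ n) : (⨅ i : ZMod n, fixSub (repL i)) = fixSub (repH (S := ZMod n)) := by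
  apply le_antisymm
  · intro X hX
    rw [Submodule.mem_iInf] at hX
    have h := CAs_range hn X (fun i => by rw [← fixL_eq i (one_ne hn i)]; exact hX i) n
    refine univ_le_fixH (CAs_anti ?_ h)
    intro k _
    refine Finset.mem_image.2 ⟨k.val, ?_, ?_⟩
    · have := ZMod.val_lt k
      simp; omega
    · simp
  · refine le_iInf fun i => ?_
    intro X hX U
    exact hX ⟨_, ringGate_unitary i (one_ne hn i) U.2⟩

theorem repL_inner (hn : 3 ≤ n) (i : ZMod n) (U) (x y) :
    inner ℂ (repL i U x) (repL i U y) = inner ℂ x y :=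
  adK_inner _ (tensorPow_unitary 3 (ringGate_unitary i (one_ne hn i) U.2)) x y

theorem repL_mul (hn : 3 ≤ n) (i : ZMod n) (U V) (x) :
    repL i (U * V) x = repL i U (repL i V x) := by
  simp only [repL]
  rw [← adK_mul, ← tensorPow_mul, ← ringGate_mul i (one_ne hn i)]
  rfl

theorem repL_cont (i : ZMod n) (x) : Continuous fun U => repL i U x :=
  adK_cont _ (tensorPow_cont _ (ringGate_cont i _ continuous_subtype_val)) x

theorem repH_inner (V : Matrix.unitaryGroup (ZMod n → Fin 2) ℂ) (x y) :
    inner ℂ (repH V x) (repH V y) = inner ℂ x y :=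
  adK_inner _ (tensorPow_unitary 3 V.2) x y

theorem repH_mul (U V : Matrix.unitaryGroup (ZMod n → Fin 2) ℂ) (x) :
    repH (U * V) x = repH U (repH V x) := by
  simp only [repH]
  rw [← adK_mul, ← tensorPow_mul]
  rfl

theorem repH_cont (x) : Continuous fun V : Matrix.unitaryGroup (ZMod n → Fin 2) ℂ => repH V x :=
  adK_cont _ (tensorPow_cont _ continuous_subtype_val) x

theorem integral_entry {G : Type*} [MeasurableSpace G] (μ : Measure G) {ι : Type*} [Fintype ι]
    (f : G → EuclideanSpace ℂ ι) (hf : Integrable f μ) (z : ι) :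
    (∫ g, f g ∂μ) z = ∫ g, f g z ∂μ :=
  ((EuclideanSpace.proj (𝕜 := ℂ) z).integral_comp_comm hf).symm

theorem localStep_eq (hn : 3 ≤ n) (μ : Measure (Matrix.unitaryGroup (Fin 2 × Fin 2) ℂ))
    [μ.IsHaarMeasure] [IsProbabilityMeasure μ]
    (X : Matrix (Fin 3 → ZMod n → Fin 2) (Fin 3 → ZMod n → Fin 2) ℂ) :
    toE (localStep n μ X) = ((n : ℂ)⁻¹) • ∑ i : ZMod n, (fixSub (repL i)).starProjection (toE X) := by
  ext z
  rw [PiLp.smul_apply, toE_apply, localStep, smul_eq_mul]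
  congr 1
  rw [WithLp.ofLp_sum, Finset.sum_apply]
  refine Finset.sum_congr rfl fun i _ => ?_
  rw [haar_proj μ (repL i) (repL_inner hn i) (repL_mul hn i) (repL_cont i),
    integral_entry μ _ (rep_integrable μ _ (repL_inner hn i) (repL_cont i) _)]
  rfl

theorem haarStep_eq (μH : Measure (Matrix.unitaryGroup (ZMod n → Fin 2) ℂ))
    [μH.IsHaarMeasure] [IsProbabilityMeasure μH]
    (X : Matrix (Fin 3 → ZMod n → Fin 2) (Fin 3 → ZMod n → Fin 2) ℂ) :
    toE (haarStep n μH X) = (fixSub (repH (S := ZMod n))).starProjection (toE X) := by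
  ext z
  rw [toE_apply, haarStep]
  rw [haar_proj μH _ repH_inner repH_mul repH_cont,
    integral_entry μH _ (rep_integrable μH _ repH_inner repH_cont _)]
  rfl

theorem fixL_comm (hn : 3 ≤ n) (μ : Measure (Matrix.unitaryGroup (Fin 2 × Fin 2) ℂ))
    [μ.IsHaarMeasure] [IsProbabilityMeasure μ] (i j : ZMod n) (h1 : j ≠ i) (h2 : j ≠ i + 1)
    (h3 : i ≠ j + 1) (x) (hx : x ∈ fixSub (repL j)) :
    (fixSub (repL i)).starProjection x ∈ fixSub (repL j) := by
  intro V
  rw [haar_proj μ (repL i) (repL_inner hn i) (repL_mul hn i) (repL_cont i)]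
  refine comm_avg μ _ (repL_inner hn i) (repL_cont i) x _ (fun U => ?_) (hx V)
  simp only [repL]
  rw [← adK_mul, ← adK_mul, ← tensorPow_mul, ← tensorPow_mul,
    ringGate_comm i j (one_ne hn i) (one_ne hn j) h1 h2 h3]

end Final2

theorem local_random_circuit_three_design
    (n : ℕ) [NeZero n] (hn : 3 ≤ n)
    (μ : Measure (Matrix.unitaryGroup (Fin 2 × Fin 2) ℂ))
    [μ.IsHaarMeasure] [IsProbabilityMeasure μ]
    (μH : Measure (Matrix.unitaryGroup (ZMod n → Fin 2) ℂ))
    [μH.IsHaarMeasure] [IsProbabilityMeasure μH] :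
    ∀ (k : ℕ) (X : Matrix (Fin 3 → ZMod n → Fin 2) (Fin 3 → ZMod n → Fin 2) ℂ),
      frobNorm ((localStep n μ)^[k] X - haarStep n μH X) ≤
        (1 - 1 / (5 * (n : ℝ))) ^ k * frobNorm X := by
  intro k X
  have hk := knabe n hn (fun i : ZMod n => fixSub (repL i)) ?_ ?_
    (fun v => toE (localStep n μ (toE.symm v))) ?_ k (toE X)
  · have hit : ∀ k : ℕ, (fun v => toE (localStep n μ (toE.symm v)))^[k] (toE X) =
        toE ((localStep n μ)^[k] X) := by
      intro k
      induction k with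
      | zero => rfl
      | succ k ih =>
        rw [Function.iterate_succ_apply', ih, Function.iterate_succ_apply']
        simp
    rw [hit, fixH_eq hn, ← haarStep_eq μH, ← map_sub, toE_norm, toE_norm] at hk
    exact hk
  · intro i x hx y hy hx0 hy0
    beta_reduce at hx hy hx0 hy0
    rw [fixL_eq _ (one_ne hn _)] at hx hy
    rw [fixL_eq _ (one_ne hn _), fixL_eq _ (one_ne hn _)] at hx0 hy0
    have s : CAs {i, i + 1, i + 1 + 1} ≤ CAs {i, i + 1} ⊓ CAs {i + 1, i + 1 + 1} :=
      le_inf (CAs_anti (by intro l; simp; tauto)) (CAs_anti (by intro l; simp; tauto))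
    exact gap_ineq i (i + 1) (i + 1 + 1) (one_ne hn _).symm (one_ne hn _).symm (two_ne hn _) x y hx hy
      (fun z hz => hx0 z (s hz)) (fun z hz => hy0 z (s hz))
  · intro i j h1 h2 h3 x hx
    exact fixL_comm hn μ i j h1 h2 h3 x hx
  · intro v
    rw [localStep_eq hn]
    simp
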